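/- arXiv:2310.15475 — 4 statements merged into one kernel-verified Lean document; each statement's English description precedes it below -/
import Mathlib

section
/- Let R be a Cohen–Macaulay commutative noetherian ring and G a finitely generated R-module. Then there exists a nonnegative integer n such that the n-th syzygy Ω^n G is a maximal Cohen–Macaulay R-module; in fact, any n greater than or equal to the restricted flat dimension rfd_R(G) = sup_{p ∈ Spec R}(depth R_p − depth G_p) works. -/
open IsLocalRing

/-- The depth of a module over a local ring: the supremum of lengths of weakly regular
sequences consisting of elements of the maximal ideal. -/
noncomputable def moduleDepth (A : Type) [CommRing A] [IsLocalRing A]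
    (M : Type) [AddCommGroup M] [Module A M] : ℕ∞ :=
  sSup {n : ℕ∞ | ∃ rs : List A, (rs.length : ℕ∞) = n ∧
    (∀ x ∈ rs, x ∈ maximalIdeal A) ∧ RingTheory.Sequence.IsWeaklyRegular M rs}

/-- Maximal Cohen–Macaulay: `depth M_p ≥ dim R_p` for every prime `p`. -/
def IsMaximalCohenMacaulay (R : Type) [CommRing R]
    (M : Type) [AddCommGroup M] [Module R M] : Prop :=
  ∀ p : PrimeSpectrum R,
    ringKrullDim (Localization.AtPrime p.asIdeal) ≤
      (moduleDepth (Localization.AtPrime p.asIdeal)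
        (LocalizedModule p.asIdeal.primeCompl M) : WithBot ℕ∞)

/-- The (large) restricted flat dimension
`rfd_R(G) = sup_{p ∈ Spec R} (depth R_p − depth G_p)`. -/
noncomputable def restrictedFlatDimension (R : Type) [CommRing R]
    (G : Type) [AddCommGroup G] [Module R G] : ℕ∞ :=
  ⨆ p : PrimeSpectrum R,
    moduleDepth (Localization.AtPrime p.asIdeal) (Localization.AtPrime p.asIdeal) -
      moduleDepth (Localization.AtPrime p.asIdeal) (LocalizedModule p.asIdeal.primeCompl G)

/-- `IsSyzygy R n S M` : `S` is an `n`-th syzygy of `M`. -/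
def IsSyzygy (R : Type) [CommRing R] : ℕ → ModuleCat R → ModuleCat R → Prop
  | 0, S, M => Nonempty (S ≃ₗ[R] M)
  | n + 1, S, M => ∃ (P : ModuleCat R) (f : P →ₗ[R] M),
      Module.Finite R P ∧ Module.Projective R P ∧ Function.Surjective f ∧
      IsSyzygy R n S (ModuleCat.of R (LinearMap.ker f))


open CategoryTheory Abelian

/-- Ext-theoretic version of `n ≤ depth M`. -/
def DepthGE (A : Type) [CommRing A] [IsLocalRing A]
    (M : Type) [AddCommGroup M] [Module A M] (n : ℕ) : Prop :=
  ∀ i < n, Subsingleton (Ext (ModuleCat.of A (A ⧸ maximalIdeal A)) (ModuleCat.of A M) i)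

namespace DepthGE

section loc

variable {A : Type} [CommRing A] [IsLocalRing A]
  {K F M : Type} [AddCommGroup K] [Module A K] [AddCommGroup F] [Module A F]
  [AddCommGroup M] [Module A M]

lemma zero : DepthGE A M 0 := fun i hi => absurd hi (Nat.not_lt_zero i)

lemma mono {m n : ℕ} (h : m ≤ n) (hn : DepthGE A M n) : DepthGE A M m :=
  fun i hi => hn i (hi.trans_le h)

lemma retract {n : ℕ} (i : M →ₗ[A] F) (r : F →ₗ[A] M) (h : r ∘ₗ i = LinearMap.id)
    (hF : DepthGE A F n) : DepthGE A M n := by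
  intro j hj
  have := hF j hj
  refine subsingleton_of_forall_eq 0 fun x => ?_
  have h1 : x = (x.comp (Ext.mk₀ (ModuleCat.ofHom i)) (add_zero j)).comp
      (Ext.mk₀ (ModuleCat.ofHom r)) (add_zero j) := by
    rw [Ext.comp_assoc_of_third_deg_zero, Ext.mk₀_comp_mk₀, ← ModuleCat.ofHom_comp, h]
    exact (Ext.comp_mk₀_id x).symm
  rw [h1, Subsingleton.elim (x.comp (Ext.mk₀ (ModuleCat.ofHom i)) (add_zero j)) 0, Ext.zero_comp]

lemma equiv {n : ℕ} (e : F ≃ₗ[A] M) (hF : DepthGE A F n) : DepthGE A M n :=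
  retract e.symm.toLinearMap e.toLinearMap (by ext; simp) hF

lemma of_subsingleton {n : ℕ} [Subsingleton M] : DepthGE A M n := by
  intro j hj
  refine subsingleton_of_forall_eq 0 fun x => ?_
  have h1 : x = x.comp (Ext.mk₀ (𝟙 _)) (add_zero j) := (Ext.comp_mk₀_id x).symm
  have h2 : 𝟙 (ModuleCat.of A M) = 0 := by
    ext m
    exact Subsingleton.elim (α := M) _ _
  rw [h1, h2]
  simp

variable {f : K →ₗ[A] F} {g : F →ₗ[A] M}

set_option linter.unusedSectionVars false in
lemma ses (hf : Function.Injective f) (hg : Function.Surjective g)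
    (hfg : Function.Exact f g) :
    (ModuleCat.shortComplexOfCompEqZero f g hfg.linearMap_comp_eq_zero).ShortExact :=
  ModuleCat.shortComplex_shortExact _ hfg hf hg

lemma left (hf : Function.Injective f) (hg : Function.Surjective g)
    (hfg : Function.Exact f g) {n : ℕ} (hF : DepthGE A F (n + 1)) (hM : DepthGE A M n) :
    DepthGE A K (n + 1) := by
  intro j hj
  have := hF j hj
  cases j with
  | zero =>
    have hS := ses hf hg hfg
    have := hS.mono_f
    exact (Ext.postcomp_mk₀_injective_of_mono _
      (ModuleCat.shortComplexOfCompEqZero f g hfg.linearMap_comp_eq_zero).f).subsingleton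
  | succ j =>
    have := hM j (by omega)
    refine subsingleton_of_forall_eq 0 fun x => ?_
    obtain ⟨y, rfl⟩ := Ext.covariant_sequence_exact₁ _ (ses hf hg hfg) x
      (hF (j+1) hj |>.elim _ _) rfl
    rw [(hM j (by omega)).elim y 0]
    simp

lemma right (hf : Function.Injective f) (hg : Function.Surjective g)
    (hfg : Function.Exact f g) {n : ℕ} (hF : DepthGE A F n) (hK : DepthGE A K (n + 1)) :
    DepthGE A M n := by
  intro j hj
  refine subsingleton_of_forall_eq 0 fun x => ?_
  obtain ⟨y, rfl⟩ := Ext.covariant_sequence_exact₃ _ (ses hf hg hfg) x rfl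
      (hK (j+1) (by omega) |>.elim _ _)
  rw [(hF j hj).elim y 0]
  simp

lemma middle (hf : Function.Injective f) (hg : Function.Surjective g)
    (hfg : Function.Exact f g) {n : ℕ} (hK : DepthGE A K n) (hM : DepthGE A M n) :
    DepthGE A F n := by
  intro j hj
  refine subsingleton_of_forall_eq 0 fun x => ?_
  obtain ⟨y, rfl⟩ := Ext.covariant_sequence_exact₂ _ (ses hf hg hfg) x
      (hM j hj |>.elim _ _)
  rw [(hK j hj).elim y 0]
  simp

lemma prod {n : ℕ} (hK : DepthGE A K n) (hM : DepthGE A M n) : DepthGE A (K × M) n :=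
  middle (f := LinearMap.inl A K M) (g := LinearMap.snd A K M) LinearMap.inl_injective
    LinearMap.snd_surjective (by intro x; simp [Prod.ext_iff, eq_comm]) hK hM

lemma pi {n : ℕ} (h : DepthGE A M n) : ∀ k : ℕ, DepthGE A (Fin k → M) n
  | 0 => of_subsingleton
  | k + 1 => equiv (Fin.consLinearEquiv A (fun _ : Fin (k + 1) => M)) (prod h (pi h k))

/-- multiplication by `x` in the maximal ideal -/
lemma cons {x : A} (hx : x ∈ maximalIdeal A) {g : F →ₗ[A] M} (hreg : IsSMulRegular F x)
    (hg : Function.Surjective g) (hfg : Function.Exact (LinearMap.lsmul A F x) g) {n : ℕ}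
    (hM : DepthGE A M n) : DepthGE A F (n + 1) := by
  have key : ∀ j, ∀ y : Ext (ModuleCat.of A (A ⧸ maximalIdeal A)) (ModuleCat.of A F) j,
      y.comp (Ext.mk₀ (ModuleCat.ofHom (LinearMap.lsmul A F x))) (add_zero j) = 0 := by
    intro j y
    have h1 := Ext.postcomp_smul_id_eq_zero_of_mem_annihilator (M := ModuleCat.of A F)
      (N := ModuleCat.of A (A ⧸ maximalIdeal A)) (r := x)
      (by rw [Ideal.annihilator_quotient]; exact hx) j
    exact congrArg (fun t => t.hom y) h1
  have hS := ses (f := LinearMap.lsmul A F x) hreg hg hfg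
  intro j hj
  refine subsingleton_of_forall_eq 0 fun y => ?_
  cases j with
  | zero =>
    have := hS.mono_f
    apply Ext.postcomp_mk₀_injective_of_mono _
      (ModuleCat.shortComplexOfCompEqZero (LinearMap.lsmul A F x) g hfg.linearMap_comp_eq_zero).f
    rw [map_zero]
    exact key 0 y
  | succ j =>
    obtain ⟨z, rfl⟩ := Ext.covariant_sequence_exact₁ _ hS y (key _ y) rfl
    rw [(hM j (by omega)).elim z 0]
    simp

lemma exists_regular [IsNoetherianRing A] [Module.Finite A M] (h : DepthGE A M 1) :
    ∃ x ∈ maximalIdeal A, IsSMulRegular M x := by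
  have h0 := h 0 one_pos
  have h1 : Subsingleton (ModuleCat.of A (A ⧸ maximalIdeal A) ⟶ ModuleCat.of A M) :=
    Ext.addEquiv₀.subsingleton_congr.mp h0
  have h2 : Subsingleton ((A ⧸ maximalIdeal A) →ₗ[A] M) := (ModuleCat.homAddEquiv (M := ModuleCat.of A (A ⧸ maximalIdeal A))
      (N := ModuleCat.of A M)).symm.subsingleton
  obtain ⟨x, hx, hr⟩ := IsSMulRegular.subsingleton_linearMap_iff.mp h2
  rw [Ideal.annihilator_quotient] at hx
  exact ⟨x, hx, hr⟩

lemma quot {x : A} (hreg : IsSMulRegular F x) {g : F →ₗ[A] M}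
    (hg : Function.Surjective g) (hfg : Function.Exact (LinearMap.lsmul A F x) g) {n : ℕ}
    (hF : DepthGE A F (n + 1)) : DepthGE A M n :=
  right (f := LinearMap.lsmul A F x) hreg hg hfg (hF.mono (Nat.le_succ n)) hF

lemma of_seq : ∀ (rs : List A) (M : Type) [AddCommGroup M] [Module A M],
    (∀ x ∈ rs, x ∈ maximalIdeal A) → RingTheory.Sequence.IsWeaklyRegular M rs →
    DepthGE A M rs.length
  | [], _, _, _, _, _ => zero
  | x :: rs, M, _, _, hm, hr => by
    rw [RingTheory.Sequence.isWeaklyRegular_cons_iff] at hr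
    exact cons (hm x (by simp)) hr.1 (Submodule.mkQ_surjective _)
      (LinearMap.exact_lsmul_mkQ_smul_top M x)
      (of_seq rs _ (fun y hy => hm y (by simp [hy])) hr.2)

lemma exists_seq [IsNoetherianRing A] : ∀ (n : ℕ) (M : Type) [AddCommGroup M] [Module A M]
    [Module.Finite A M], DepthGE A M n → ∃ rs : List A, rs.length = n ∧
    (∀ x ∈ rs, x ∈ maximalIdeal A) ∧ RingTheory.Sequence.IsWeaklyRegular M rs
  | 0, M, _, _, _, _ => ⟨[], by simp⟩
  | n + 1, M, _, _, _, h => by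
    obtain ⟨x, hx, hr⟩ := exists_regular (h.mono (by omega))
    obtain ⟨rs, h1, h2, h3⟩ := exists_seq n (QuotSMulTop x M)
      (quot hr (Submodule.mkQ_surjective _) (LinearMap.exact_lsmul_mkQ_smul_top M x) h)
    exact ⟨x :: rs, by simp [h1], by
      rintro y hy
      rcases List.mem_cons.mp hy with rfl | hy
      · exact hx
      · exact h2 y hy, RingTheory.Sequence.IsWeaklyRegular.cons hr h3⟩

lemma le_moduleDepth_iff [IsNoetherianRing A] [Module.Finite A M] {n : ℕ} :
    (n : ℕ∞) ≤ moduleDepth A M ↔ DepthGE A M n := by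
  constructor
  · intro h
    cases n with
    | zero => exact zero
    | succ n =>
      have h' : (n : ℕ∞) < moduleDepth A M := by
        refine lt_of_lt_of_le ?_ h
        exact_mod_cast Nat.lt_succ_self n
      obtain ⟨_, ⟨rs, rfl, h2, h3⟩, h4⟩ := lt_sSup_iff.mp h'
      have h5 : n < rs.length := by exact_mod_cast h4
      exact (of_seq rs M h2 h3).mono h5
  · intro h
    obtain ⟨rs, h1, h2, h3⟩ := exists_seq n M h
    exact le_sSup ⟨rs, by rw [h1], h2, h3⟩

end loc

end DepthGE

/-- Depth of the localization at `p` is at least `n`. -/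
abbrev DP {R : Type} [CommRing R] (p : PrimeSpectrum R) (M : Type) [AddCommGroup M] [Module R M]
    (n : ℕ) : Prop :=
  DepthGE (Localization.AtPrime p.asIdeal) (LocalizedModule p.asIdeal.primeCompl M) n

namespace DP

open scoped Pointwise

variable {R : Type} [CommRing R] {p : PrimeSpectrum R}
  {K F M : Type} [AddCommGroup K] [Module R K] [AddCommGroup F] [Module R F]
  [AddCommGroup M] [Module R M]

lemma retract {n : ℕ} (i : M →ₗ[R] F) (r : F →ₗ[R] M) (h : r ∘ₗ i = LinearMap.id)
    (hF : DP p F n) : DP p M n := by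
  refine DepthGE.retract (LocalizedModule.map p.asIdeal.primeCompl i)
    (LocalizedModule.map p.asIdeal.primeCompl r) ?_ hF
  ext x
  induction x using LocalizedModule.induction_on with
  | _ m s =>
    have := LinearMap.congr_fun h m
    simp only [LinearMap.comp_apply, LinearMap.id_apply] at this
    simp [LocalizedModule.map_mk, this]

lemma equiv {n : ℕ} (e : F ≃ₗ[R] M) (hF : DP p F n) : DP p M n :=
  retract e.symm.toLinearMap e.toLinearMap (by ext; simp) hF

variable {f : K →ₗ[R] F} {g : F →ₗ[R] M}

lemma left (hf : Function.Injective f) (hg : Function.Surjective g)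
    (hfg : Function.Exact f g) {n : ℕ} (hF : DP p F (n + 1)) (hM : DP p M n) :
    DP p K (n + 1) :=
  DepthGE.left (f := LocalizedModule.map p.asIdeal.primeCompl f)
    (g := LocalizedModule.map p.asIdeal.primeCompl g)
    (LocalizedModule.map_injective _ f hf) (LocalizedModule.map_surjective _ g hg)
    (LocalizedModule.map_exact _ f g hfg) hF hM

lemma right (hf : Function.Injective f) (hg : Function.Surjective g)
    (hfg : Function.Exact f g) {n : ℕ} (hF : DP p F n) (hK : DP p K (n + 1)) :
    DP p M n :=
  DepthGE.right (f := LocalizedModule.map p.asIdeal.primeCompl f)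
    (g := LocalizedModule.map p.asIdeal.primeCompl g)
    (LocalizedModule.map_injective _ f hf) (LocalizedModule.map_surjective _ g hg)
    (LocalizedModule.map_exact _ f g hfg) hF hK

lemma middle (hf : Function.Injective f) (hg : Function.Surjective g)
    (hfg : Function.Exact f g) {n : ℕ} (hK : DP p K n) (hM : DP p M n) :
    DP p F n :=
  DepthGE.middle (f := LocalizedModule.map p.asIdeal.primeCompl f)
    (g := LocalizedModule.map p.asIdeal.primeCompl g)
    (LocalizedModule.map_injective _ f hf) (LocalizedModule.map_surjective _ g hg)
    (LocalizedModule.map_exact _ f g hfg) hK hM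

lemma prod {n : ℕ} (hK : DP p K n) (hM : DP p M n) : DP p (K × M) n :=
  middle (f := LinearMap.inl R K M) (g := LinearMap.snd R K M) LinearMap.inl_injective
    LinearMap.snd_surjective (by intro x; simp [Prod.ext_iff, eq_comm]) hK hM

lemma of_subsingleton {n : ℕ} [Subsingleton M] : DP p M n :=
  DepthGE.of_subsingleton

lemma pi {n : ℕ} (h : DP p M n) : ∀ k : ℕ, DP p (Fin k → M) n
  | 0 => of_subsingleton
  | k + 1 => equiv (Fin.consLinearEquiv R (fun _ : Fin (k + 1) => M)) (prod h (pi h k))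

lemma projective [Module.Finite R M] [Module.Projective R M] {n : ℕ} (h : DP p R n) :
    DP p M n := by
  obtain ⟨k, g, hg⟩ := Module.Finite.exists_fin' R M
  obtain ⟨s, hs⟩ := Module.projective_lifting_property g LinearMap.id hg
  exact retract s g hs (pi h k)

lemma exact_aux (y : R) :
    Function.Exact (LinearMap.lsmul (Localization.AtPrime p.asIdeal)
      (LocalizedModule p.asIdeal.primeCompl M) (algebraMap R _ y))
      (LocalizedModule.map p.asIdeal.primeCompl (Submodule.mkQ (y • (⊤ : Submodule R M)))) := by
  have h := LocalizedModule.map_exact p.asIdeal.primeCompl _ _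
    (LinearMap.exact_lsmul_mkQ_smul_top M y)
  have e : ∀ x, LinearMap.lsmul (Localization.AtPrime p.asIdeal)
      (LocalizedModule p.asIdeal.primeCompl M) (algebraMap R _ y) x =
      LocalizedModule.map p.asIdeal.primeCompl (LinearMap.lsmul R M y) x := by
    intro x
    induction x using LocalizedModule.induction_on with
    | _ m s => 
      rw [LocalizedModule.map_mk, LinearMap.lsmul_apply, algebraMap_smul]
      simp [LocalizedModule.smul'_mk]
  intro z
  rw [show (z ∈ Set.range _ ↔ z ∈ Set.range _) from by
    simp only [Set.mem_range, e]; exact Iff.rfl]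
  exact h z

lemma cons {y : R} (hy : y ∈ p.asIdeal)
    (hr : IsSMulRegular (LocalizedModule p.asIdeal.primeCompl M) y) {n : ℕ}
    (h : DP p (QuotSMulTop y M) n) : DP p M (n + 1) :=
  DepthGE.cons (x := algebraMap R _ y)
    ((IsLocalization.AtPrime.to_map_mem_maximal_iff _ p.asIdeal y).mpr hy)
    (by rwa [isSMulRegular_algebraMap_iff])
    (LocalizedModule.map_surjective _ _ (Submodule.mkQ_surjective _)) (exact_aux y) h

lemma quot {y : R}
    (hr : IsSMulRegular (LocalizedModule p.asIdeal.primeCompl M) y) {n : ℕ}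
    (h : DP p M (n + 1)) : DP p (QuotSMulTop y M) n :=
  DepthGE.quot (x := algebraMap R _ y)
    (by rwa [isSMulRegular_algebraMap_iff])
    (LocalizedModule.map_surjective _ _ (Submodule.mkQ_surjective _)) (exact_aux y) h

lemma exists_regular [IsNoetherianRing R] [Module.Finite R M] (h : DP p M 1) :
    ∃ y ∈ p.asIdeal, IsSMulRegular (LocalizedModule p.asIdeal.primeCompl M) y := by
  obtain ⟨x, hx, hr⟩ := DepthGE.exists_regular h
  obtain ⟨⟨y, s⟩, hs⟩ := IsLocalization.surj p.asIdeal.primeCompl x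
  simp only at hs
  refine ⟨y, ?_, ?_⟩
  · rw [← IsLocalization.AtPrime.to_map_mem_maximal_iff (Localization.AtPrime p.asIdeal) p.asIdeal, ← hs]
    exact Ideal.mul_mem_right _ _ hx
  · rw [← isSMulRegular_algebraMap_iff (Localization.AtPrime p.asIdeal), ← hs]
    exact hr.mul ((IsLocalization.map_units _ s).isSMulRegular _)

lemma mk_zero_iff {S : Submonoid R} {m : M} {s : S} :
    LocalizedModule.mk m s = 0 ↔ ∃ t : S, t • m = 0 := by
  rw [← LocalizedModule.zero_mk 1, LocalizedModule.mk_eq]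
  simp

lemma regular_iff {y : R} : IsSMulRegular (LocalizedModule p.asIdeal.primeCompl M) y ↔
    ∀ m : M, y • m = 0 → ∃ s ∉ p.asIdeal, s • m = 0 := by
  constructor
  · intro h m hm
    have h1 : LocalizedModule.mkLinearMap p.asIdeal.primeCompl M m = 0 := by
      apply h
      simp only [smul_zero]
      rw [← map_smul, hm, map_zero]
    obtain ⟨s, hs⟩ := (IsLocalizedModule.eq_zero_iff p.asIdeal.primeCompl _).mp h1
    exact ⟨s, s.2, hs⟩
  · intro h
    rw [isSMulRegular_iff_right_eq_zero_of_smul]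
    intro x hx
    induction x using LocalizedModule.induction_on with
    | _ m s =>
      rw [LocalizedModule.smul'_mk, mk_zero_iff] at hx
      obtain ⟨t, ht⟩ := hx
      obtain ⟨u, hu, hu'⟩ := h ((t : R) • m) (by rw [smul_comm]; exact ht)
      rw [mk_zero_iff]
      exact ⟨⟨u, hu⟩ * t, by rw [mul_smul]; exact hu'⟩

lemma spread_regular [IsNoetherianRing R] [Module.Finite R M] {y : R}
    (h : IsSMulRegular (LocalizedModule p.asIdeal.primeCompl M) y) :
    ∃ f ∉ p.asIdeal, ∀ p' : PrimeSpectrum R, f ∉ p'.asIdeal →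
      IsSMulRegular (LocalizedModule p'.asIdeal.primeCompl M) y := by
  rw [regular_iff] at h
  let N := LinearMap.ker (LinearMap.lsmul R M y)
  have h1 : p ∉ Module.support R N := by
    rw [Module.notMem_support_iff']
    rintro ⟨m, hm⟩
    obtain ⟨s, hs, hs'⟩ := h m hm
    exact ⟨s, hs, Subtype.ext hs'⟩
  rw [Module.mem_support_iff_of_finite, SetLike.not_le_iff_exists] at h1
  obtain ⟨f, hf, hfp⟩ := h1
  refine ⟨f, hfp, fun p' hp' => regular_iff.mpr fun m hm => ⟨f, hp', ?_⟩⟩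
  exact congrArg Subtype.val (Module.mem_annihilator.mp hf ⟨m, hm⟩)

end DP

section main

set_option linter.unusedSectionVars false

variable {R : Type} [CommRing R] [IsNoetherianRing R]

/-- All primes of the support of `M` below `q` have height at least `ht q - h`. -/
def HtCond (q : PrimeSpectrum R) (h : ℕ) (M : Type) [AddCommGroup M] [Module R M] : Prop :=
  ∀ p ∈ Module.support R M, p ≤ q → q.asIdeal.height ≤ p.asIdeal.height + h

lemma ht_lt {p q : PrimeSpectrum R} (h : p < q) : p.asIdeal.height < q.asIdeal.height :=
  Ideal.height_strict_mono_of_isPrime h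

lemma HtCond.eq {q : PrimeSpectrum R} {M : Type} [AddCommGroup M] [Module R M]
    (h : HtCond q 0 M) {p : PrimeSpectrum R} (hp : p ∈ Module.support R M) (hpq : p ≤ q) :
    p = q := by
  by_contra hne
  have h1 := ht_lt (lt_of_le_of_ne hpq hne)
  have h2 := h p hp hpq
  simp only [Nat.cast_zero, add_zero] at h2
  exact absurd h2 (not_le.mpr h1)

lemma filt {q : PrimeSpectrum R} {M : Type} [AddCommGroup M] [Module R M] [hM : Module.Finite R M]
    (hC : HtCond q 0 M) : ∃ f ∉ q.asIdeal, ∀ p : PrimeSpectrum R, f ∉ p.asIdeal →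
      ∀ n, DP p (R ⧸ q.asIdeal) n → DP p M n := by
  induction hM using IsNoetherianRing.induction_on_isQuotientEquivQuotientPrime R with
  | subsingleton N =>
    exact ⟨1, q.asIdeal.one_notMem, fun p _ n _ => DP.of_subsingleton⟩
  | quotient N p' e =>
    by_cases hle : p' ≤ q
    · have hmem : p' ∈ Module.support R N := by
        rw [e.support_eq, Module.mem_support_iff_of_finite, Ideal.annihilator_quotient]
      have := hC.eq hmem hle
      subst this
      exact ⟨1, p'.asIdeal.one_notMem, fun p _ n h => DP.equiv e.symm h⟩
    · obtain ⟨f, hf, hfq⟩ := SetLike.not_le_iff_exists.mp (show ¬ p'.asIdeal ≤ q.asIdeal from hle)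
      refine ⟨f, hfq, fun p hp n _ => ?_⟩
      have : Subsingleton (LocalizedModule p.asIdeal.primeCompl N) := by
        rw [← Module.notMem_support_iff, e.support_eq, Module.mem_support_iff_of_finite,
          Ideal.annihilator_quotient]
        exact fun hh => hp (hh hf)
      exact DepthGE.of_subsingleton
  | exact N₁ N₂ N₃ f g hf hg hfg ih1 ih3 =>
    have hs := Module.support_of_exact hfg hf hg
    obtain ⟨f1, h1, h1'⟩ := ih1 (fun p hp => hC p (by rw [hs]; exact Or.inl hp))
    obtain ⟨f3, h3, h3'⟩ := ih3 (fun p hp => hC p (by rw [hs]; exact Or.inr hp))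
    refine ⟨f1 * f3, fun h => (q.2.mem_or_mem h).elim h1 h3, fun p hp n hn => ?_⟩
    exact DP.middle hf hg hfg (h1' p (fun h => hp (Ideal.mul_mem_right _ _ h)) n hn)
      (h3' p (fun h => hp (Ideal.mul_mem_left _ _ h)) n hn)

/-- below each prime of the support there is an associated prime -/
lemma exists_assoc {q : PrimeSpectrum R} {M : Type} [AddCommGroup M] [Module R M]
    [Module.Finite R M] (hq : q ∈ Module.support R M) :
    ∃ p ∈ Module.support R M, p ≤ q ∧ IsAssociatedPrime p.asIdeal M := by
  rw [Module.mem_support_iff_of_finite] at hq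
  obtain ⟨P, hP, hPq⟩ := Ideal.exists_minimalPrimes_le hq
  refine ⟨⟨P, hP.1.1⟩, ?_, hPq, 
    Module.associatedPrimes.minimalPrimes_annihilator_subset_associatedPrimes R M hP⟩
  rw [Module.mem_support_iff_of_finite]
  exact hP.1.2

lemma HtCond.step {q : PrimeSpectrum R} {M : Type} [AddCommGroup M] [Module R M]
    [Module.Finite R M] {h : ℕ} (hC : HtCond q (h + 1) M) {y : R}
    (hr : IsSMulRegular (LocalizedModule q.asIdeal.primeCompl M) y) :
    HtCond q h (QuotSMulTop y M) := by
  intro p hp hpq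
  rw [Module.support_quotSMulTop] at hp
  obtain ⟨p', hp', hle, hass⟩ := exists_assoc hp.1
  have hlt : p'.asIdeal < p.asIdeal := by
    refine lt_of_le_of_ne hle fun heq => ?_
    obtain ⟨_, x, hx⟩ := isAssociatedPrime_iff.mp hass
    have hy : y ∈ p'.asIdeal := by
      rw [heq]
      exact hp.2 rfl
    have hmem : ∀ r, r ∈ p'.asIdeal ↔ r • x = 0 := by
      intro r
      rw [hx]
      simp [Submodule.mem_colon_singleton]
    obtain ⟨s, hs, hs'⟩ := DP.regular_iff.mp hr x ((hmem y).mp hy)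
    exact hs (hpq (hle ((hmem s).mpr hs')))
  have h1 := hC p' hp' (hle.trans hpq)
  have h2 : p'.asIdeal.height + 1 ≤ p.asIdeal.height := by
    refine Order.add_one_le_of_lt ?_
    exact ht_lt hlt
  calc _ ≤ _ := h1
    _ = p'.asIdeal.height + 1 + h := by push_cast; ring
    _ ≤ _ := by gcongr

lemma bottom {q : PrimeSpectrum R} {M : Type} [AddCommGroup M] [Module R M] [Module.Finite R M]
    (hq : q ∈ Module.support R M) (hC : HtCond q 0 M) :
    ∃ f ∉ q.asIdeal, ∀ p : PrimeSpectrum R, f ∉ p.asIdeal →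
      ∀ n, DP p M n → DP p (R ⧸ q.asIdeal) n := by
  obtain ⟨p', hp', hle, hass⟩ := exists_assoc hq
  have := hC.eq hp' hle
  subst this
  obtain ⟨_, i, hi⟩ := (isAssociatedPrime_iff_exists_injective_linearMap _ _).mp hass
  have hex := LinearMap.exact_map_mkQ_range i
  have hs := Module.support_subset_of_surjective _ (Submodule.mkQ_surjective (LinearMap.range i))
  obtain ⟨f, hf, hf'⟩ := filt (q := p') (M := M ⧸ LinearMap.range i) (fun p hp => hC p (hs hp))
  refine ⟨f, hf, fun p hp n hn => ?_⟩
  have key : ∀ j ≤ n, DP p (R ⧸ p'.asIdeal) j := by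
    intro j
    induction j with
    | zero => exact fun _ => DepthGE.zero
    | succ j ih =>
      intro hj
      exact DP.left hi (Submodule.mkQ_surjective _) hex (DepthGE.mono hj hn)
        (hf' p hp j (ih (by omega)))
  exact key n le_rfl

lemma spread (q : PrimeSpectrum R) : ∀ (h : ℕ) (A M : Type) [AddCommGroup A] [Module R A]
    [Module.Finite R A] [AddCommGroup M] [Module R M] [Module.Finite R M],
    DP q A h → DP q M h → q ∈ Module.support R A → HtCond q h A → HtCond q h M →
    ∃ f ∉ q.asIdeal, ∀ p : PrimeSpectrum R, q ≤ p → f ∉ p.asIdeal →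
      ∀ n, DP p A n → DP p M n
  | 0, A, M, _, _, _, _, _, _, _, _, hq, hA, hM => by
    obtain ⟨f1, h1, h1'⟩ := bottom hq hA
    obtain ⟨f3, h3, h3'⟩ := filt hM
    refine ⟨f1 * f3, fun h => (q.2.mem_or_mem h).elim h1 h3, fun p _ hp n hn => ?_⟩
    exact h3' p (fun h => hp (Ideal.mul_mem_left _ _ h)) n
      (h1' p (fun h => hp (Ideal.mul_mem_right _ _ h)) n hn)
  | h + 1, A, M, _, _, _, _, _, _, dA, dM, hq, hA, hM => by
    obtain ⟨y, hyq, hy⟩ := DP.exists_regular (DepthGE.mono (by omega) (DP.prod dA dM))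
    have hyA : IsSMulRegular (LocalizedModule q.asIdeal.primeCompl A) y := by
      rw [DP.regular_iff] at hy ⊢
      intro a ha
      obtain ⟨s, hs, hs'⟩ := hy (a, 0) (by simp [ha])
      exact ⟨s, hs, congrArg Prod.fst hs'⟩
    have hyM : IsSMulRegular (LocalizedModule q.asIdeal.primeCompl M) y := by
      rw [DP.regular_iff] at hy ⊢
      intro a ha
      obtain ⟨s, hs, hs'⟩ := hy (0, a) (by simp [ha])
      exact ⟨s, hs, congrArg Prod.snd hs'⟩
    obtain ⟨f1, h1, h1'⟩ := DP.spread_regular hyA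
    obtain ⟨f2, h2, h2'⟩ := DP.spread_regular hyM
    obtain ⟨f3, h3, h3'⟩ := spread q h (QuotSMulTop y A) (QuotSMulTop y M) (DP.quot hyA dA)
      (DP.quot hyM dM)
      (by rw [Module.support_quotSMulTop]; exact ⟨hq, by simpa using hyq⟩)
      (hA.step hyA) (hM.step hyM)
    refine ⟨f1 * f2 * f3, fun h => (q.2.mem_or_mem h).elim
      (fun h => (q.2.mem_or_mem h).elim h1 h2) h3, fun p hqp hp n hn => ?_⟩
    cases n with
    | zero => exact DepthGE.zero
    | succ n =>
      have g1 := h1' p fun h => hp (Ideal.mul_mem_right _ _ (Ideal.mul_mem_right _ _ h))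
      have g2 := h2' p fun h => hp (Ideal.mul_mem_right _ _ (Ideal.mul_mem_left _ _ h))
      exact DP.cons (hqp hyq) g2 (h3' p hqp (fun h => hp (Ideal.mul_mem_left _ _ h)) n
        (DP.quot g1 hn))

lemma syz_up (p : PrimeSpectrum R) {m : ℕ} (hR : DP p R m) : ∀ (n : ℕ) (S M : ModuleCat.{0} R),
    IsSyzygy R n S M → DP p M (m - n) → DP p S m
  | 0, S, M, ⟨e⟩, h => DP.equiv e.symm h
  | n + 1, S, M, ⟨P, f, _, _, hf, hS⟩, h => by
    refine syz_up p hR n S _ hS ?_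
    rcases Nat.eq_zero_or_pos (m - n) with h0 | h0
    · rw [h0]; exact DepthGE.zero
    · have e : m - n = m - (n + 1) + 1 := by omega
      rw [e]
      exact DP.left (f := (LinearMap.ker f).subtype) (g := f) Subtype.val_injective hf
        (LinearMap.exact_subtype_ker_map f) (DepthGE.mono (by omega) (DP.projective hR)) h

lemma syz_down (p : PrimeSpectrum R) {m : ℕ} (hR : DP p R m) : ∀ (n : ℕ) (S M : ModuleCat.{0} R),
    IsSyzygy R n S M → DP p S m → DP p M (m - n)
  | 0, S, M, ⟨e⟩, h => DP.equiv e h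
  | n + 1, S, M, ⟨P, f, _, _, hf, hS⟩, h => by
    have ih := syz_down p hR n S _ hS h
    rcases Nat.eq_zero_or_pos (m - n) with h0 | h0
    · rw [show m - (n + 1) = 0 by omega]; exact DepthGE.zero
    · have e : m - n = m - (n + 1) + 1 := by omega
      rw [e] at ih
      exact DP.right (f := (LinearMap.ker f).subtype) (g := f) Subtype.val_injective hf
        (LinearMap.exact_subtype_ker_map f) (DepthGE.mono (by omega) (DP.projective hR)) ih

lemma syz_finite : ∀ (n : ℕ) (S M : ModuleCat.{0} R), IsSyzygy R n S M → Module.Finite R M →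
    Module.Finite R S
  | 0, _, _, ⟨e⟩, _ => Module.Finite.equiv e.symm
  | n + 1, S, _, ⟨P, f, _, _, _, hS⟩, _ => syz_finite n S _ hS
      (inferInstanceAs (Module.Finite R (LinearMap.ker f)))

lemma syz_exists : ∀ (n : ℕ) (M : ModuleCat.{0} R), Module.Finite R M →
    ∃ S : ModuleCat.{0} R, IsSyzygy R n S M
  | 0, M, _ => ⟨M, ⟨LinearEquiv.refl R M⟩⟩
  | n + 1, M, _ => by
    obtain ⟨k, f, hf⟩ := Module.Finite.exists_fin' R M
    obtain ⟨S, hS⟩ := syz_exists n (ModuleCat.of R (LinearMap.ker f))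
      (inferInstanceAs (Module.Finite R (LinearMap.ker f)))
    exact ⟨S, ModuleCat.of R (Fin k → R), f, inferInstanceAs (Module.Finite R (Fin k → R)),
      inferInstanceAs (Module.Projective R (Fin k → R)), hf, hS⟩

/-- the localization of `R` as a module over itself -/
lemma dp_self (p : PrimeSpectrum R) (n : ℕ) : DP p R n ↔
    DepthGE (Localization.AtPrime p.asIdeal) (Localization.AtPrime p.asIdeal) n := by
  let e : LocalizedModule p.asIdeal.primeCompl R ≃ₗ[Localization.AtPrime p.asIdeal]
      Localization.AtPrime p.asIdeal :=
    (IsLocalizedModule.iso p.asIdeal.primeCompl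
      (Algebra.linearMap R (Localization.AtPrime p.asIdeal))).extendScalarsOfIsLocalization
      p.asIdeal.primeCompl _
  exact ⟨DepthGE.equiv e, DepthGE.equiv e.symm⟩

lemma local_bound (hCM : IsMaximalCohenMacaulay R R) (G : ModuleCat.{0} R) [Module.Finite R G]
    (q : PrimeSpectrum R) :
    ∃ N : ℕ, ∃ f ∉ q.asIdeal, ∀ p : PrimeSpectrum R, q ≤ p → f ∉ p.asIdeal →
      ∀ n, DP p R n → DP p G (n - N) := by
  obtain ⟨h, hh⟩ := ENat.ne_top_iff_exists.mp (Ideal.height_ne_top_of_isPrime (I := q.asIdeal))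
  have hR : DP q R h := by
    have := hCM q
    rw [IsLocalization.AtPrime.ringKrullDim_eq_height q.asIdeal, ← hh] at this
    exact DepthGE.le_moduleDepth_iff.mp (by exact_mod_cast this)
  obtain ⟨S, hS⟩ := syz_exists h G inferInstance
  have hfin := syz_finite h S G hS inferInstance
  have hSd : DP q S h := syz_up q hR h S G hS (by rw [Nat.sub_self]; exact DepthGE.zero)
  have triv : ∀ (M : Type) [AddCommGroup M] [Module R M], HtCond q h M := by
    intro M _ _ p _ _
    rw [← hh]
    exact le_add_self
  obtain ⟨f, hf, hf'⟩ := spread q h R S hR hSd (by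
    rw [Module.mem_support_iff_of_finite]
    intro r hr
    have := Module.mem_annihilator.mp hr 1
    simp only [smul_eq_mul, mul_one] at this
    rw [this]
    exact q.asIdeal.zero_mem) (triv _) (triv _)
  exact ⟨h, f, hf, fun p hqp hp n hn => syz_down p hn h S G hS (hf' p hqp hp n hn)⟩

lemma global_bound (hCM : IsMaximalCohenMacaulay R R) (G : ModuleCat.{0} R) [Module.Finite R G]
    (I : Ideal R) : ∃ N : ℕ, ∀ p : PrimeSpectrum R, I ≤ p.asIdeal →
      ∀ n, DP p R n → DP p G (n - N) := by
  induction I using IsNoetherian.induction with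
  | hgt I ih =>
    have ext : ∀ a ∉ I, ∃ N : ℕ, ∀ p : PrimeSpectrum R, I ≤ p.asIdeal → a ∈ p.asIdeal →
        ∀ n, DP p R n → DP p G (n - N) := by
      intro a ha
      obtain ⟨N, hN⟩ := ih (I ⊔ Ideal.span {a}) (by
        refine lt_of_le_of_ne le_sup_left fun he => ha ?_
        rw [he]
        exact Ideal.mem_sup_right (Ideal.mem_span_singleton_self a))
      exact ⟨N, fun p hp hap => hN p
        (sup_le hp ((Ideal.span_singleton_le_iff_mem _).mpr hap))⟩
    by_cases hI : Ideal.IsPrime I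
    · obtain ⟨N1, f, hf, hf'⟩ := local_bound hCM G ⟨I, hI⟩
      obtain ⟨N2, h2⟩ := ext f hf
      refine ⟨max N1 N2, fun p hp n hn => ?_⟩
      by_cases hfp : f ∈ p.asIdeal
      · exact DepthGE.mono (by omega) (h2 p hp hfp n hn)
      · exact DepthGE.mono (by omega) (hf' p hp hfp n hn)
    · by_cases ht : I = ⊤
      · refine ⟨0, fun p hp => absurd (top_le_iff.mp (ht ▸ hp)) p.2.ne_top⟩
      · rw [Ideal.isPrime_iff] at hI
        push Not at hI
        obtain ⟨a, b, hab, ha, hb⟩ := hI ht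
        obtain ⟨N1, h1⟩ := ext a ha
        obtain ⟨N2, h2⟩ := ext b hb
        refine ⟨max N1 N2, fun p hp n hn => ?_⟩
        rcases p.2.mem_or_mem (hp hab) with h | h
        · exact DepthGE.mono (by omega) (h1 p hp h n hn)
        · exact DepthGE.mono (by omega) (h2 p hp h n hn)

lemma enat_le {a b : ℕ∞} (h : ∀ n : ℕ, (n : ℕ∞) ≤ a → (n : ℕ∞) ≤ b) : a ≤ b :=
  ENat.forall_natCast_le_iff_le.mp h

lemma rfd_le_iff (G : Type) [AddCommGroup G] [Module R G] [Module.Finite R G] (N : ℕ) :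
    restrictedFlatDimension R G ≤ (N : ℕ∞) ↔
      ∀ p : PrimeSpectrum R, ∀ n, DP p R n → DP p G (n - N) := by
  unfold restrictedFlatDimension
  rw [iSup_le_iff]
  refine forall_congr' fun p => ?_
  rw [tsub_le_iff_right]
  constructor
  · intro h n hn
    rw [dp_self, ← DepthGE.le_moduleDepth_iff] at hn
    refine DepthGE.le_moduleDepth_iff.mp ?_
    have := hn.trans h
    rw [ENat.natCast_sub]
    rw [tsub_le_iff_left]
    exact this
  · intro h
    refine enat_le fun n hn => ?_
    rw [DepthGE.le_moduleDepth_iff, ← dp_self] at hn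
    have h1 := DepthGE.le_moduleDepth_iff.mpr (h n hn)
    calc (n : ℕ∞) ≤ ((N + (n - N) : ℕ) : ℕ∞) := by exact_mod_cast (by omega)
      _ = (N : ℕ∞) + ((n - N : ℕ) : ℕ∞) := by push_cast; rfl
      _ ≤ _ := by gcongr

end main
theorem stmt_8 (R : Type) [CommRing R] [IsNoetherianRing R]
    (hCM : IsMaximalCohenMacaulay R R) (G : ModuleCat R) [Module.Finite R G] :
    (∃ n : ℕ, ∀ S : ModuleCat R, IsSyzygy R n S G → IsMaximalCohenMacaulay R S) ∧
    ∀ n : ℕ, restrictedFlatDimension R G ≤ (n : ℕ∞) →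
      ∀ S : ModuleCat R, IsSyzygy R n S G → IsMaximalCohenMacaulay R S := by
  have h2 : ∀ n : ℕ, restrictedFlatDimension R G ≤ (n : ℕ∞) →
      ∀ S : ModuleCat R, IsSyzygy R n S G → IsMaximalCohenMacaulay R S := by
    intro n hn S hS p
    rw [rfd_le_iff] at hn
    have hfin := syz_finite n S G hS inferInstance
    refine (hCM p).trans (WithBot.coe_le_coe.mpr (enat_le fun m hm => ?_))
    rw [DepthGE.le_moduleDepth_iff] at hm ⊢
    exact syz_up p hm n S G hS (hn p m hm)
  refine ⟨?_, h2⟩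
  obtain ⟨N, hN⟩ := global_bound hCM G ⊥
  exact ⟨N, h2 N ((rfd_le_iff G N).mpr fun p => hN p bot_le)⟩
end

section
/- Let T be a triangulated category with a classical generator G, and let t be a real number such that δ_t(G, G) = 0. Then δ_t(H, T) = 0 for every classical generator H of T and every object T of T. -/
open CategoryTheory CategoryTheory.Limits CategoryTheory.Pretriangulated

universe v u

variable (C : Type u) [Category.{v} C] [HasZeroObject C] [HasShift C ℤ] [Preadditive C]
  [∀ n : ℤ, (shiftFunctor C n).Additive] [Pretriangulated C] [HasBinaryBiproducts C]

/-- Membership in the thick closure of `X`: the smallest class containing `X` and closed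
under shifts, direct summands and triangles (hence a thick subcategory). -/
inductive InThick (X : C) : C → Prop
  | base : InThick X X
  | shift (Y : C) (n : ℤ) : InThick X Y → InThick X (Y⟦n⟧)
  | summand (Y Z W : C) (e : Y ≅ Z ⊞ W) : InThick X Y → InThick X Z
  | ext (T : Triangle C) (hT : T ∈ distTriang C) :
      InThick X T.obj₁ → InThick X T.obj₃ → InThick X T.obj₂

/-- The DHKK complexity `δ_t(X, Y)`: the infimum of `Σ e^{nᵢ t}` over all towers of exact
triangles with cones shifts `X[nᵢ]` building `Y ⊕ Y'` from `0`. -/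
noncomputable def dhkkDelta (t : ℝ) (X Y : C) : ENNReal :=
  sInf {s : ENNReal | ∃ (r : ℕ) (n : Fin r → ℤ) (Yc : Fin (r + 1) → C) (Y' : C),
    IsZero (Yc 0) ∧ Nonempty (Yc (Fin.last r) ≅ Y ⊞ Y') ∧
    (∀ i : Fin r, ∃ (f : Yc i.castSucc ⟶ Yc i.succ) (g : Yc i.succ ⟶ X⟦n i⟧)
      (h : X⟦n i⟧ ⟶ (Yc i.castSucc)⟦(1 : ℤ)⟧), Triangle.mk f g h ∈ distTriang C) ∧
    s = ENNReal.ofReal (∑ i, Real.exp ((n i : ℝ) * t))}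


/-- An object `G` is a classical generator if its thick closure is the whole category. -/
def IsClassicalGenerator (G : C) : Prop := ∀ Y : C, InThick C G Y

/-- Towers over shifts of `X`, with their cost. -/
inductive Tow (t : ℝ) (X : C) : ℝ → C → Prop
  | zero (Z : C) : IsZero Z → Tow t X 0 Z
  | step (c : ℝ) (F F' : C) (n : ℤ) (f : F ⟶ F') (g : F' ⟶ X⟦n⟧) (h : X⟦n⟧ ⟶ F⟦(1 : ℤ)⟧) :
      Triangle.mk f g h ∈ distTriang C → Tow t X c F → Tow t X (c + Real.exp ((n : ℝ) * t)) F'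

lemma tow_of_fin (t : ℝ) (X : C) (r : ℕ) : ∀ (n : Fin r → ℤ) (Yc : Fin (r + 1) → C)
    (_ : IsZero (Yc 0))
    (_ : ∀ i : Fin r, ∃ (f : Yc i.castSucc ⟶ Yc i.succ) (g : Yc i.succ ⟶ X⟦n i⟧)
      (h : X⟦n i⟧ ⟶ (Yc i.castSucc)⟦(1 : ℤ)⟧), Triangle.mk f g h ∈ distTriang C),
    Tow C t X (∑ i, Real.exp ((n i : ℝ) * t)) (Yc (Fin.last r)) := by
  induction r with
  | zero => intro n Yc h0 _; simpa using Tow.zero _ h0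
  | succ r ih =>
    intro n Yc h0 hs
    rw [Fin.sum_univ_castSucc]
    obtain ⟨f, g, h, hd⟩ := hs (Fin.last r)
    refine Tow.step _ _ _ _ f g h hd ?_
    exact ih (fun i => n i.castSucc) (fun i => Yc i.castSucc) h0 (fun i => hs i.castSucc)

lemma fin_of_tow (t : ℝ) (X : C) (c : ℝ) (F : C) (hF : Tow C t X c F) :
    ∃ (r : ℕ) (n : Fin r → ℤ) (Yc : Fin (r + 1) → C),
    IsZero (Yc 0) ∧ Yc (Fin.last r) = F ∧
    (∀ i : Fin r, ∃ (f : Yc i.castSucc ⟶ Yc i.succ) (g : Yc i.succ ⟶ X⟦n i⟧)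
      (h : X⟦n i⟧ ⟶ (Yc i.castSucc)⟦(1 : ℤ)⟧), Triangle.mk f g h ∈ distTriang C) ∧
    c = ∑ i, Real.exp ((n i : ℝ) * t) := by
  induction hF with
  | zero Z hZ => exact ⟨0, Fin.elim0, fun _ => Z, hZ, rfl, fun i => i.elim0, by simp⟩
  | step c F F' m f g h hd _ ih =>
    obtain ⟨r, n, Yc, h0, hl, hs, hc⟩ := ih
    subst hl
    refine ⟨r + 1, Fin.snoc (α := fun _ => ℤ) n m, Fin.snoc (α := fun _ => C) Yc F', ?_, ?_, ?_, ?_⟩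
    · have : (0 : Fin (r + 1 + 1)) = Fin.castSucc 0 := rfl
      rw [this, Fin.snoc_castSucc]; exact h0
    · simp
    · intro i
      refine Fin.lastCases ?_ (fun i => ?_) i
      · rw [Fin.succ_last, Fin.snoc_castSucc, Fin.snoc_last, Fin.snoc_last]
        exact ⟨f, g, h, hd⟩
      · rw [Fin.succ_castSucc, Fin.snoc_castSucc, Fin.snoc_castSucc, Fin.snoc_castSucc]
        exact hs i
    · rw [Fin.sum_univ_castSucc]; simp [hc]

/-- Every map from `A` to the cone of a tower over `Z` is killed after enlarging the tower
at additional cost `c`. -/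
def Kill (t : ℝ) (X A : C) (c : ℝ) : Prop :=
  ∀ (Z F W : C) (u : F ⟶ Z) (v : Z ⟶ W) (w : W ⟶ F⟦(1 : ℤ)⟧),
    Triangle.mk u v w ∈ distTriang C → ∀ s : ℝ, Tow C t X s F → ∀ a : A ⟶ W,
    ∃ (F' W' : C) (u' : F' ⟶ Z) (v' : Z ⟶ W') (w' : W' ⟶ F'⟦(1 : ℤ)⟧) (p : W ⟶ W'),
      Triangle.mk u' v' w' ∈ distTriang C ∧ Tow C t X (s + c) F' ∧ v ≫ p = v' ∧ a ≫ p = 0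

lemma kill_base (t : ℝ) (X : C) (n : ℤ) :
    Kill C t X (X⟦n⟧) (2 * Real.exp ((n : ℝ) * t)) := by
  intro Z F W u v w hd s hs a
  obtain ⟨F₁, f, g, hfg⟩ := distinguished_cocone_triangle₂ (a ≫ w)
  obtain ⟨u₁, hu₁, hu₁'⟩ : ∃ u₁ : F₁ ⟶ Z, f ≫ u₁ = 𝟙 F ≫ u ∧ g ≫ a = u₁ ≫ v :=
    complete_distinguished_triangle_morphism₂ _ _ hfg hd (𝟙 F) a (by
      change (a ≫ w) ≫ (shiftFunctor C (1 : ℤ)).map (𝟙 F) = a ≫ w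
      rw [CategoryTheory.Functor.map_id, Category.comp_id])
  obtain ⟨W₁, v₁, w₁, hd₁⟩ := distinguished_cocone_triangle u₁
  obtain ⟨p, hp, hp'⟩ : ∃ p : W ⟶ W₁, v ≫ p = 𝟙 Z ≫ v₁ ∧ w ≫ f⟦(1 : ℤ)⟧' = p ≫ w₁ :=
    complete_distinguished_triangle_morphism _ _ hd hd₁ f (𝟙 Z) (by
      change u ≫ 𝟙 Z = f ≫ u₁
      rw [hu₁]; simp)
  have hz : (a ≫ p) ≫ w₁ = 0 := by
    have h1 : (a ≫ w) ≫ f⟦(1 : ℤ)⟧' = 0 := comp_distTriang_mor_zero₃₁ _ hfg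
    rw [Category.assoc, ← hp', ← Category.assoc, h1]
  obtain ⟨z, hz⟩ : ∃ z : X⟦n⟧ ⟶ Z, a ≫ p = z ≫ v₁ :=
    Triangle.coyoneda_exact₃ _ hd₁ (a ≫ p) hz
  obtain ⟨W₂, v₂, w₂, hd₂⟩ := distinguished_cocone_triangle (biprod.desc u₁ z)
  obtain ⟨q, hq, -⟩ : ∃ q : W₁ ⟶ W₂, v₁ ≫ q = 𝟙 Z ≫ v₂ ∧ w₁ ≫ biprod.inl⟦(1 : ℤ)⟧' = q ≫ w₂ :=
    complete_distinguished_triangle_morphism _ _ hd₁ hd₂ biprod.inl (𝟙 Z) (by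
      change u₁ ≫ 𝟙 Z = biprod.inl ≫ biprod.desc u₁ z
      simp)
  have hz2 : z ≫ v₂ = 0 := by
    have h1 : biprod.desc u₁ z ≫ v₂ = 0 := comp_distTriang_mor_zero₁₂ _ hd₂
    have h2 := biprod.inr ≫= h1
    simpa using h2
  refine ⟨_, W₂, _, v₂, w₂, p ≫ q, hd₂, ?_, ?_, ?_⟩
  · have e : s + 2 * Real.exp ((n : ℝ) * t) =
      (s + Real.exp ((n : ℝ) * t)) + Real.exp ((n : ℝ) * t) := by ring
    rw [e]
    exact Tow.step _ _ _ n _ _ _ (binaryBiproductTriangle_distinguished F₁ (X⟦n⟧))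
      (Tow.step _ _ _ n _ _ _ hfg hs)
  · rw [← Category.assoc, hp, Category.assoc, hq]; simp
  · rw [← Category.assoc, hz, Category.assoc, hq]; simpa using hz2

variable {C} in
lemma Kill.retract {t : ℝ} {X A B : C} {c : ℝ} (h : Kill C t X A c) (i : B ⟶ A) (r : A ⟶ B)
    (hir : i ≫ r = 𝟙 B) : Kill C t X B c := by
  intro Z F W u v w hd s hs a
  obtain ⟨F', W', u', v', w', p, h1, h2, h3, h4⟩ := h Z F W u v w hd s hs (r ≫ a)
  refine ⟨F', W', u', v', w', p, h1, h2, h3, ?_⟩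
  rw [← Category.id_comp a, ← hir, Category.assoc, Category.assoc]
  rw [Category.assoc] at h4
  rw [h4, comp_zero]

variable {C} in
lemma Kill.ext {t : ℝ} {X : C} (T : Triangle C) (hT : T ∈ distTriang C) {c d : ℝ}
    (h₁ : Kill C t X T.obj₁ c) (h₃ : Kill C t X T.obj₃ d) : Kill C t X T.obj₂ (c + d) := by
  intro Z F W u v w hd s hs a
  obtain ⟨F', W', u', v', w', p, k1, k2, k3, k4⟩ := h₁ Z F W u v w hd s hs (T.mor₁ ≫ a)
  rw [Category.assoc] at k4
  obtain ⟨b, hb⟩ := Triangle.yoneda_exact₂ T hT _ k4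
  obtain ⟨F₂, W₂, u₂, v₂, w₂, q, l1, l2, l3, l4⟩ := h₃ Z F' W' u' v' w' k1 _ k2 b
  refine ⟨F₂, W₂, u₂, v₂, w₂, p ≫ q, l1, by rwa [← add_assoc], ?_, ?_⟩
  · rw [← Category.assoc, k3, l3]
  · rw [← Category.assoc, hb, Category.assoc, l4, comp_zero]

/-- Shift-uniform version of `Kill`. -/
def KillS (t : ℝ) (X A : C) (c : ℝ) : Prop :=
  ∀ n : ℤ, Kill C t X (A⟦n⟧) (c * Real.exp ((n : ℝ) * t))

variable {C}

lemma KillS.shift {t : ℝ} {X A : C} {c : ℝ} (h : KillS C t X A c) (m : ℤ) :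
    KillS C t X (A⟦m⟧) (c * Real.exp ((m : ℝ) * t)) := by
  intro n
  have e : c * Real.exp ((m : ℝ) * t) * Real.exp ((n : ℝ) * t) =
      c * Real.exp (((m + n : ℤ) : ℝ) * t) := by
    rw [mul_assoc, ← Real.exp_add]; push_cast; ring_nf
  rw [e]
  exact (h (m + n)).retract ((shiftFunctorAdd C m n).inv.app A) ((shiftFunctorAdd C m n).hom.app A)
    (by simp)

lemma KillS.summand {t : ℝ} {X Y Z W : C} {c : ℝ} (h : KillS C t X Y c) (e : Y ≅ Z ⊞ W) :
    KillS C t X Z c := by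
  intro n
  refine (h n).retract ((biprod.inl ≫ e.inv)⟦n⟧') ((e.hom ≫ biprod.fst)⟦n⟧') ?_
  rw [← Functor.map_comp]; simp

lemma KillS.ext {t : ℝ} {X : C} (T : Triangle C) (hT : T ∈ distTriang C) {c d : ℝ}
    (h₁ : KillS C t X T.obj₁ c) (h₃ : KillS C t X T.obj₃ d) :
    KillS C t X T.obj₂ (c + d) := by
  intro n
  rw [add_mul]
  exact Kill.ext _ (Triangle.shift_distinguished T hT n) (h₁ n) (h₃ n)

lemma KillS.of_isZero {t : ℝ} {X A : C} (hA : IsZero A) : KillS C t X A 0 := by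
  intro n Z F W u v w hd s hs a
  refine ⟨F, W, u, v, w, 𝟙 W, hd, by simpa using hs, by simp, ?_⟩
  exact ((shiftFunctor C n).map_isZero hA).eq_of_src _ _

lemma KillS.of_tow {t : ℝ} {X G : C} {c : ℝ} (h : KillS C t X G c) {s : ℝ} {A : C}
    (hA : Tow C t G s A) : KillS C t X A (c * s) := by
  induction hA with
  | zero Z hZ => simpa using KillS.of_isZero hZ
  | step s F F' n f g k hd _ ih =>
    rw [mul_add]
    exact KillS.ext _ hd ih (h.shift n)

lemma KillS.exists_of_inThick {t : ℝ} {X Y : C} (h : InThick C X Y) :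
    ∃ c : ℝ, 0 < c ∧ KillS C t X Y c := by
  induction h with
  | base => exact ⟨2, two_pos, fun n => kill_base C t X n⟩
  | shift Y n _ ih =>
    obtain ⟨c, hc, h⟩ := ih
    exact ⟨_, by positivity, h.shift n⟩
  | summand Y Z W e _ ih =>
    obtain ⟨c, hc, h⟩ := ih
    exact ⟨c, hc, h.summand e⟩
  | ext T hT _ _ ih₁ ih₃ =>
    obtain ⟨c, hc, h⟩ := ih₁
    obtain ⟨d, hd, h'⟩ := ih₃
    exact ⟨_, by positivity, KillS.ext T hT h h'⟩

lemma KillS.small_of_inThick {t : ℝ} {X G Y : C}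
    (hG : ∀ ε > 0, ∃ s ≤ ε, KillS C t X G s)
    (h : InThick C G Y) : ∀ ε > 0, ∃ s ≤ ε, KillS C t X Y s := by
  induction h with
  | base => exact hG
  | shift Y n _ ih =>
    intro ε hε
    obtain ⟨s, hs, hk⟩ := ih (ε / Real.exp ((n : ℝ) * t)) (by positivity)
    exact ⟨_, (le_div_iff₀ (Real.exp_pos _)).1 hs, hk.shift n⟩
  | summand Y Z W e _ ih =>
    intro ε hε
    obtain ⟨s, hs, hk⟩ := ih ε hε
    exact ⟨s, hs, hk.summand e⟩
  | ext T hT _ _ ih₁ ih₃ =>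
    intro ε hε
    obtain ⟨s, hs, hk⟩ := ih₁ (ε / 2) (by positivity)
    obtain ⟨s', hs', hk'⟩ := ih₃ (ε / 2) (by positivity)
    exact ⟨s + s', by linarith, KillS.ext T hT hk hk'⟩

lemma dhkkDelta_le_of_killS {t : ℝ} {X Y : C} {c : ℝ} (h : KillS C t X Y c) :
    dhkkDelta C t X Y ≤ ENNReal.ofReal c := by
  have h0 : Kill C t X Y c := by
    have := (h 0).retract ((shiftFunctorZero C ℤ).inv.app Y) ((shiftFunctorZero C ℤ).hom.app Y)
      (by simp)
    simpa using this
  obtain ⟨W₀, v₀, w₀, hd₀⟩ := distinguished_cocone_triangle (0 : (HasZeroObject.zero' C).zero ⟶ Y)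
  obtain ⟨F, W, u, v, w, p, hd, hF, hv, hp⟩ :=
    h0 Y _ W₀ _ v₀ w₀ hd₀ 0 (Tow.zero _ (isZero_zero C)) v₀
  have hv0 : v = 0 := by rw [← hv, hp]
  obtain ⟨e, -, -⟩ := exists_iso_binaryBiproduct_of_distTriang _
    (inv_rot_of_distTriang _ hd) (by
      change v ≫ _ = 0
      rw [hv0]; exact zero_comp)
  obtain ⟨r, n, Yc, k0, kl, ks, kc⟩ := fin_of_tow C t X _ F hF
  subst kl
  refine sInf_le ⟨r, n, Yc, _, k0, ⟨e ≪≫ biprod.braiding _ _⟩, ks, ?_⟩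
  rw [← kc, zero_add]

variable (C)

/-- If `G` is a classical generator with `δ_t(G, G) = 0`, then
`δ_t(H, T) = 0` for every classical generator `H` and every object `T`. -/
theorem stmt_11 (G : C) (hG : IsClassicalGenerator C G) (t : ℝ)
    (h : dhkkDelta C t G G = 0) :
    ∀ (H T : C), IsClassicalGenerator C H → dhkkDelta C t H T = 0 := by
  intro H T hH
  obtain ⟨c, hc, hK⟩ := KillS.exists_of_inThick (t := t) (hH G)
  have hGs : ∀ ε > 0, ∃ s ≤ ε, KillS C t H G s := by
    intro ε hε
    have hε' : 0 < ε / c := by positivity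
    have hlt : dhkkDelta C t G G < ENNReal.ofReal (ε / c) := by
      rw [h]; exact ENNReal.ofReal_pos.2 hε'
    obtain ⟨_, ⟨r, n, Yc, Y', k0, ⟨e⟩, ks, rfl⟩, hs⟩ := sInf_lt_iff.1 hlt
    exact ⟨_, (le_div_iff₀' hc).1 ((ENNReal.ofReal_lt_ofReal_iff hε').1 hs).le,
      (hK.of_tow (tow_of_fin C t G r n Yc k0 ks)).summand e⟩
  refine le_antisymm (ENNReal.le_of_forall_pos_le_add fun ε hε _ => ?_) zero_le
  obtain ⟨s, hs, hk⟩ := KillS.small_of_inThick hGs (hG T) ε (by exact_mod_cast hε)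
  rw [zero_add, ← ENNReal.ofReal_coe_nnreal]
  exact (dhkkDelta_le_of_killS hk).trans (ENNReal.ofReal_le_ofReal hs)
end

section
/- Let T be a triangulated category that is n-periodic for some positive integer n (the shift functor [n] is isomorphic to the identity), let X, Y ∈ T with Y ∈ thick(X), and let t be a nonzero real number. Then δ_t(X, Y) = 0. -/
open CategoryTheory CategoryTheory.Limits CategoryTheory.Pretriangulated

universe v u

variable (C : Type u) [Category.{v} C] [HasZeroObject C] [HasShift C ℤ] [Preadditive C]
  [∀ n : ℤ, (shiftFunctor C n).Additive] [Pretriangulated C] [HasBinaryBiproducts C]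

/-- Existence of a distinguished triangle with given objects. -/
def ExTri (A B D : C) : Prop :=
  ∃ (f : A ⟶ B) (g : B ⟶ D) (h : D ⟶ A⟦(1 : ℤ)⟧), Triangle.mk f g h ∈ distTriang C

variable {C}

theorem ExTri.of_dist (T : Triangle C) (hT : T ∈ distTriang C) : ExTri C T.obj₁ T.obj₂ T.obj₃ :=
  ⟨T.mor₁, T.mor₂, T.mor₃, hT⟩

theorem ExTri.iso {A B D A' B' D' : C} (h : ExTri C A B D) (e₁ : A' ≅ A) (e₂ : B' ≅ B)
    (e₃ : D' ≅ D) : ExTri C A' B' D' := by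
  obtain ⟨f, g, h, hT⟩ := h
  refine ⟨e₁.hom ≫ f ≫ e₂.inv, e₂.hom ≫ g ≫ e₃.inv, e₃.hom ≫ h ≫ e₁.inv⟦(1 : ℤ)⟧', ?_⟩
  refine isomorphic_distinguished _ hT _ (Triangle.isoMk _ _ e₁ e₂ e₃ ?_ ?_ ?_)
  · change (e₁.hom ≫ f ≫ e₂.inv) ≫ e₂.hom = e₁.hom ≫ f
    simp
  · change (e₂.hom ≫ g ≫ e₃.inv) ≫ e₃.hom = e₂.hom ≫ g
    simp
  · change (e₃.hom ≫ h ≫ e₁.inv⟦(1 : ℤ)⟧') ≫ e₁.hom⟦(1 : ℤ)⟧' = e₃.hom ≫ h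
    simp [← Functor.map_comp]

theorem ExTri.rot {A B D : C} (h : ExTri C A B D) : ExTri C B D (A⟦(1 : ℤ)⟧) := by
  obtain ⟨f, g, h, hT⟩ := h
  exact ExTri.of_dist _ (rot_of_distTriang _ hT)

theorem ExTri.of_rot {A B D : C} (h : ExTri C B D (A⟦(1 : ℤ)⟧)) : ExTri C A B D := by
  obtain ⟨f, g, h, hT⟩ := h
  exact (ExTri.of_dist _ (inv_rot_of_distTriang _ hT)).iso
    ((shiftEquiv C (1 : ℤ)).unitIso.app A) (Iso.refl _) (Iso.refl _)

theorem ExTri.shift {A B D : C} (h : ExTri C A B D) (n : ℤ) :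
    ExTri C (A⟦n⟧) (B⟦n⟧) (D⟦n⟧) := by
  obtain ⟨f, g, h, hT⟩ := h
  exact ExTri.of_dist _ (Triangle.shift_distinguished _ hT n)

noncomputable def biprodIsoPi (f : Bool → C) : f true ⊞ f false ≅ ∏ᶜ f where
  hom := Pi.lift (fun b => match b with
    | true => biprod.fst
    | false => biprod.snd)
  inv := biprod.lift (Pi.π f true) (Pi.π f false)
  hom_inv_id := by ext <;> simp
  inv_hom_id := by
    apply Pi.hom_ext
    rintro (_ | _) <;> simp

theorem ExTri.biprod {A B D A' B' D' : C} (h : ExTri C A B D) (h' : ExTri C A' B' D') :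
    ExTri C (A ⊞ A') (B ⊞ B') (D ⊞ D') := by
  obtain ⟨f, g, h, hT⟩ := h
  obtain ⟨f', g', h', hT'⟩ := h'
  let T : Bool → Triangle C := fun b => match b with
    | true => Triangle.mk f g h
    | false => Triangle.mk f' g' h'
  have := productTriangle_distinguished T (by rintro (_ | _) <;> assumption)
  exact (ExTri.of_dist _ this).iso (biprodIsoPi (fun j => (T j).obj₁))
    (biprodIsoPi (fun j => (T j).obj₂)) (biprodIsoPi (fun j => (T j).obj₃))

noncomputable def biprodZeroIso (A Z : C) (hZ : IsZero Z) : A ≅ A ⊞ Z where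
  hom := biprod.inl
  inv := biprod.fst
  hom_inv_id := by simp
  inv_hom_id := by
    ext
    · simp
    · exact hZ.eq_of_tgt _ _
    · exact hZ.eq_of_src _ _
    · exact hZ.eq_of_src _ _

noncomputable def zeroBiprodIso (A Z : C) (hZ : IsZero Z) : A ≅ Z ⊞ A where
  hom := biprod.inr
  inv := biprod.snd
  hom_inv_id := by simp
  inv_hom_id := by
    ext
    · exact hZ.eq_of_tgt _ _
    · exact hZ.eq_of_src _ _
    · exact hZ.eq_of_tgt _ _
    · simp

theorem ExTri.addRight {A B D : C} (h : ExTri C A B D) (V : C) :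
    ExTri C (A ⊞ V) (B ⊞ V) D :=
  (h.biprod (ExTri.of_dist _ (contractible_distinguished V))).iso (Iso.refl _) (Iso.refl _)
    (biprodZeroIso D _ (isZero_zero C))

/-- Objects with a finite tower. -/
inductive Tow_s14 (X : C) : C → Prop
  | zero (Z : C) (hZ : IsZero Z) : Tow_s14 X Z
  | step (Z Z' : C) (m : ℤ) (h : ExTri C Z Z' (X⟦m⟧)) : Tow_s14 X Z → Tow_s14 X Z'

theorem Tow_s14.iso {X Z : C} (h : Tow_s14 X Z) {Z' : C} (e : Z' ≅ Z) : Tow_s14 X Z' := by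
  cases h with
  | zero _ hZ => exact .zero _ (hZ.of_iso e)
  | step Z₀ _ m h h₀ => exact .step Z₀ _ m (h.iso (Iso.refl _) e (Iso.refl _)) h₀

theorem Tow_s14.shift {X Z : C} (h : Tow_s14 X Z) (n : ℤ) : Tow_s14 X (Z⟦n⟧) := by
  induction h with
  | zero Z hZ => exact .zero _ ((shiftFunctor C n).map_isZero hZ)
  | step Z₀ Z m h h₀ ih =>
    exact .step _ _ (m + n) ((h.shift n).iso (Iso.refl _) (Iso.refl _) (shiftAdd X m n)) ih

theorem Tow_s14.biprod {X Z W : C} (h : Tow_s14 X Z) (hW : Tow_s14 X W) : Tow_s14 X (Z ⊞ W) := by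
  induction h with
  | zero Z hZ => exact hW.iso (zeroBiprodIso W Z hZ).symm
  | step Z₀ Z m h h₀ ih => exact .step _ _ m (h.addRight W) ih

/-- Retracts of objects with a finite tower. -/
def RT (X Y : C) : Prop := ∃ Z, Tow_s14 X Z ∧ Nonempty (Retract Y Z)

theorem RT.of_retract {X Y Y' : C} (h : RT X Y) (r : Retract Y' Y) : RT X Y' := by
  obtain ⟨Z, hZ, ⟨r'⟩⟩ := h
  exact ⟨Z, hZ, ⟨r.trans r'⟩⟩

theorem RT.shift {X Y : C} (h : RT X Y) (n : ℤ) : RT X (Y⟦n⟧) := by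
  obtain ⟨Z, hZ, ⟨r'⟩⟩ := h
  exact ⟨_, hZ.shift n, ⟨r'.map (shiftFunctor C n)⟩⟩

theorem RT.biprod {X Y Y' : C} (h : RT X Y) (h' : RT X Y') : RT X (Y ⊞ Y') := by
  obtain ⟨Z, hZ, ⟨r⟩⟩ := h
  obtain ⟨Z', hZ', ⟨r'⟩⟩ := h'
  refine ⟨_, hZ.biprod hZ', ⟨⟨biprod.map r.i r'.i, biprod.map r.r r'.r, ?_⟩⟩⟩
  ext <;> simp

theorem retract_compl {Y Z : C} (r : Retract Y Z) : ∃ V : C, Nonempty (Z ≅ Y ⊞ V) := by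
  obtain ⟨V, g, h, hT⟩ := distinguished_cocone_triangle r.i
  have hm : Mono r.i := inferInstance
  obtain ⟨e, -⟩ := exists_iso_binaryBiproduct_of_distTriang _ hT
    (Triangle.mor₃_eq_zero_of_mono₁ _ hT hm)
  exact ⟨V, ⟨e⟩⟩

theorem RT.compl {X Y : C} (h : RT X Y) : ∃ V : C, Tow_s14 X (Y ⊞ V) := by
  obtain ⟨Z, hZ, ⟨r⟩⟩ := h
  obtain ⟨V, ⟨e⟩⟩ := retract_compl r
  exact ⟨V, hZ.iso e.symm⟩

theorem RT.of_compl {X Y V : C} (h : RT X (Y ⊞ V)) : RT X Y :=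
  h.of_retract ⟨biprod.inl, biprod.fst, by simp⟩

theorem RT.step {X F B : C} {m : ℤ} (hF : RT X F) (h : ExTri C F B (X⟦m⟧)) : RT X B := by
  obtain ⟨V, hV⟩ := hF.compl
  exact RT.of_compl (V := V) ⟨_, .step _ _ m (h.addRight V) hV, ⟨Retract.refl _⟩⟩

/-- Replacement for the octahedron, valid in any pretriangulated category: the
object `F` is a retract of `D ⊞ D` (after a shift). -/
theorem key {A B E E' W D F : C} (α : A ⟶ B) (β : B ⟶ E) (γ : E ⟶ A⟦(1 : ℤ)⟧)
    (h₁ : Triangle.mk α β γ ∈ distTriang C)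
    (ι : E' ⟶ E) (π : E ⟶ W) (d : W ⟶ E'⟦(1 : ℤ)⟧) (h₂ : Triangle.mk ι π d ∈ distTriang C)
    (a : A ⟶ D) (b : D ⟶ E') (h₃ : Triangle.mk a b (ι ≫ γ) ∈ distTriang C)
    (j : F ⟶ B) (κ : W ⟶ F⟦(1 : ℤ)⟧) (h₄ : Triangle.mk j (β ≫ π) κ ∈ distTriang C) :
    Nonempty (Retract (F⟦(1 : ℤ)⟧) (D⟦(1 : ℤ)⟧ ⊞ D⟦(1 : ℤ)⟧)) := by
  have z₁ : β ≫ γ = 0 := comp_distTriang_mor_zero₂₃ _ h₁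
  have z₁' : α ≫ β = 0 := comp_distTriang_mor_zero₁₂ _ h₁
  have z₂ : ι ≫ π = 0 := comp_distTriang_mor_zero₁₂ _ h₂
  have z₃ : a ≫ b = 0 := comp_distTriang_mor_zero₁₂ _ h₃
  have z₃' : (ι ≫ γ) ≫ a⟦(1 : ℤ)⟧' = 0 := comp_distTriang_mor_zero₃₁ _ h₃
  have z₄ : (β ≫ π) ≫ κ = 0 := comp_distTriang_mor_zero₂₃ _ h₄
  obtain ⟨p, hp₁, hp₂⟩ : ∃ p : F ⟶ E', j ≫ β = p ≫ ι ∧ κ ≫ p⟦(1 : ℤ)⟧' = 𝟙 W ≫ d :=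
    complete_distinguished_triangle_morphism₁ _ _ h₄ h₂ β (𝟙 W) (Category.comp_id (β ≫ π))
  obtain ⟨q, hq₁, hq₂⟩ : ∃ q : D ⟶ B, a ≫ q = 𝟙 A ≫ α ∧ b ≫ ι = q ≫ β :=
    complete_distinguished_triangle_morphism₂ _ _ h₃ h₁ (𝟙 A) ι (by
      change (ι ≫ γ) ≫ (𝟙 A)⟦(1 : ℤ)⟧' = ι ≫ γ
      simp)
  obtain ⟨u₀, hu₀⟩ : ∃ u₀ : F ⟶ D, p = u₀ ≫ b :=
    Triangle.coyoneda_exact₃ _ h₃ p (by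
      change p ≫ ι ≫ γ = 0
      rw [← Category.assoc, ← hp₁, Category.assoc, z₁, comp_zero])
  obtain ⟨s, hs⟩ : ∃ s : F ⟶ A, u₀ ≫ q - j = s ≫ α :=
    Triangle.coyoneda_exact₂ _ h₁ (u₀ ≫ q - j) (by
      change (u₀ ≫ q - j) ≫ β = 0
      rw [Preadditive.sub_comp, Category.assoc, ← hq₂, ← Category.assoc, ← hu₀, hp₁, sub_self])
  obtain ⟨u, hu, huq⟩ : ∃ u : F ⟶ D, u ≫ b = p ∧ u ≫ q = j := by
    refine ⟨u₀ - s ≫ a, ?_, ?_⟩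
    · rw [Preadditive.sub_comp, Category.assoc, z₃, comp_zero, sub_zero, hu₀]
    · rw [Preadditive.sub_comp, Category.assoc, hq₁, Category.id_comp, ← hs]
      abel
  -- the second map
  obtain ⟨K, k, l, hK⟩ := distinguished_cocone_triangle₁ (π ≫ κ)
  have hk : k ≫ π ≫ κ = 0 := comp_distTriang_mor_zero₁₂ _ hK
  obtain ⟨v, hv⟩ : ∃ v : F⟦(1 : ℤ)⟧ ⟶ D⟦(1 : ℤ)⟧, γ ≫ a⟦(1 : ℤ)⟧' = (π ≫ κ) ≫ v := by
    refine Triangle.yoneda_exact₂ _ hK (γ ≫ a⟦(1 : ℤ)⟧') ?_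
    change k ≫ γ ≫ a⟦(1 : ℤ)⟧' = 0
    obtain ⟨y, hy⟩ : ∃ y : K ⟶ B, k ≫ π = y ≫ β ≫ π :=
      Triangle.coyoneda_exact₃ _ h₄ (k ≫ π) (by
        change (k ≫ π) ≫ κ = 0
        rw [Category.assoc, hk])
    obtain ⟨x, hx⟩ : ∃ x : K ⟶ E', k - y ≫ β = x ≫ ι :=
      Triangle.coyoneda_exact₂ _ h₂ (k - y ≫ β) (by
        change (k - y ≫ β) ≫ π = 0
        rw [Preadditive.sub_comp, hy, Category.assoc, sub_self])
    have hk' : k = x ≫ ι + y ≫ β := by rw [← hx]; abel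
    rw [Category.assoc] at z₃'
    rw [hk', Preadditive.add_comp, Category.assoc, Category.assoc, z₃', reassoc_of% z₁]
    simp
  have hmono : Mono (biprod.lift (u⟦(1 : ℤ)⟧') v) := by
    rw [Preadditive.mono_iff_cancel_zero]
    intro Q w hw
    have hw₁ : w ≫ u⟦(1 : ℤ)⟧' = 0 := by
      simpa using congrArg (fun t => t ≫ biprod.fst) hw
    have hw₂ : w ≫ v = 0 := by
      simpa using congrArg (fun t => t ≫ biprod.snd) hw
    obtain ⟨x, hx⟩ : ∃ x : Q ⟶ W, w = x ≫ κ :=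
      Triangle.coyoneda_exact₁ _ h₄ w (by
        change w ≫ j⟦(1 : ℤ)⟧' = 0
        rw [← huq, Functor.map_comp, reassoc_of% hw₁, zero_comp])
    obtain ⟨c, hc⟩ : ∃ c : Q ⟶ E, x = c ≫ π :=
      Triangle.coyoneda_exact₃ _ h₂ x (by
        change x ≫ d = 0
        rw [Category.id_comp] at hp₂
        rw [← hp₂, ← Category.assoc, ← hx, ← hu, Functor.map_comp, reassoc_of% hw₁, zero_comp])
    obtain ⟨y, hy⟩ : ∃ y : Q ⟶ E', c ≫ γ = y ≫ ι ≫ γ :=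
      Triangle.coyoneda_exact₁ _ h₃ (c ≫ γ) (by
        change (c ≫ γ) ≫ a⟦(1 : ℤ)⟧' = 0
        rw [Category.assoc, hv, Category.assoc, ← Category.assoc, ← hc, ← Category.assoc, ← hx,
          hw₂])
    obtain ⟨z, hz⟩ : ∃ z : Q ⟶ B, c - y ≫ ι = z ≫ β :=
      Triangle.coyoneda_exact₃ _ h₁ (c - y ≫ ι) (by
        change (c - y ≫ ι) ≫ γ = 0
        rw [Preadditive.sub_comp, hy, Category.assoc, sub_self])
    have hc' : c = y ≫ ι + z ≫ β := by rw [← hz]; abel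
    rw [Category.assoc] at z₄
    rw [hx, hc, hc', Category.assoc, Preadditive.add_comp, Category.assoc, Category.assoc, z₄,
      reassoc_of% z₂]
    simp
  have := isSplitMono_of_mono (biprod.lift (u⟦(1 : ℤ)⟧') v)
  exact ⟨⟨_, retraction (biprod.lift (u⟦(1 : ℤ)⟧') v), IsSplitMono.id _⟩⟩

theorem RT.ext_tow {X E : C} (hE : Tow_s14 X E) :
    ∀ {A B : C}, RT X A → ExTri C A B E → RT X B := by
  induction hE with
  | zero E hE =>
    rintro A B hA ⟨f, g, h, hT⟩
    have : IsIso f := (Triangle.isZero₃_iff_isIso₁ _ hT).1 hE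
    exact hA.of_retract (Retract.ofIso (asIso f).symm)
  | step E' E m h h₀ ih =>
    rintro A B hA ⟨α, β, γ, h₁⟩
    obtain ⟨ι, π, d, h₂⟩ := h
    obtain ⟨D, a, b, h₃⟩ := distinguished_cocone_triangle₂ (ι ≫ γ)
    obtain ⟨F, j, κ, h₄⟩ := distinguished_cocone_triangle₁ (β ≫ π)
    have hD : RT X D := ih hA ⟨a, b, _, h₃⟩
    obtain ⟨r⟩ := key α β γ h₁ ι π d h₂ a b h₃ j κ h₄
    have hF1 : RT X (F⟦(1 : ℤ)⟧) := ((hD.shift 1).biprod (hD.shift 1)).of_retract r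
    have hF : RT X F := (hF1.shift (-1)).of_retract
      (Retract.ofIso ((shiftEquiv C (1 : ℤ)).unitIso.app F))
    exact hF.step ⟨j, _, κ, h₄⟩

theorem RT.ext {X A B E : C} (hA : RT X A) (hE : RT X E) (h : ExTri C A B E) : RT X B := by
  obtain ⟨V, hV⟩ := hE.compl
  exact RT.of_compl (V := V) (RT.ext_tow hV hA (h.rot.addRight V).of_rot)

theorem RT.of_inThick {X Y : C} (h : InThick C X Y) : RT X Y := by
  induction h with
  | base =>
    refine ⟨X⟦(0 : ℤ)⟧, .step _ _ 0 ?_ (.zero _ (isZero_zero C)),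
      ⟨Retract.ofIso ((shiftFunctorZero C ℤ).symm.app X)⟩⟩
    exact ExTri.of_dist _ (contractible_distinguished₁ _)
  | shift Y n _ ih => exact ih.shift n
  | summand Y Z W e _ ih => exact RT.of_compl (V := W) (ih.of_retract (Retract.ofIso e.symm))
  | ext T hT _ _ ih₁ ih₃ => exact ih₁.ext ih₃ (ExTri.of_dist T hT)

theorem period_nat (n : ℕ) (hper : Nonempty (shiftFunctor C (n : ℤ) ≅ 𝟭 C)) (X : C) (k : ℕ) :
    ∀ m : ℤ, Nonempty (X⟦m + k * n⟧ ≅ X⟦m⟧) := by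
  obtain ⟨e⟩ := hper
  induction k with
  | zero => intro m; exact ⟨eqToIso (by simp)⟩
  | succ k ih =>
    intro m
    obtain ⟨i⟩ := ih m
    exact ⟨eqToIso (by congr 2; push_cast; ring) ≪≫ shiftAdd X (m + k * n) (n : ℤ) ≪≫
      e.app _ ≪≫ i⟩

theorem period_small (n : ℕ) (hn : 0 < n) (hper : Nonempty (shiftFunctor C (n : ℤ) ≅ 𝟭 C))
    (X : C) (t : ℝ) (ht : t ≠ 0) (m : ℤ) (ε : ℝ) (hε : 0 < ε) :
    ∃ m' : ℤ, Nonempty (X⟦m'⟧ ≅ X⟦m⟧) ∧ Real.exp ((m' : ℝ) * t) < ε := by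
  have hn' : (0 : ℝ) < n := by exact_mod_cast hn
  have hpos : 0 < (n : ℝ) * |t| := mul_pos hn' (abs_pos.2 ht)
  obtain ⟨k, hk⟩ := exists_nat_gt (((m : ℝ) * t - Real.log ε) / ((n : ℝ) * |t|))
  rw [div_lt_iff₀ hpos] at hk
  rcases lt_or_gt_of_ne ht with h | h
  · refine ⟨m + k * n, period_nat n hper X k m, ?_⟩
    rw [← Real.lt_log_iff_exp_lt hε]
    rw [abs_of_neg h] at hk
    push_cast
    linarith
  · refine ⟨m - k * n, ?_, ?_⟩
    · obtain ⟨i⟩ := period_nat n hper X k (m - k * n)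
      exact ⟨i.symm ≪≫ eqToIso (by congr 2; ring)⟩
    · rw [← Real.lt_log_iff_exp_lt hε]
      rw [abs_of_pos h] at hk
      push_cast
      linarith

theorem Tow_s14.cost (n : ℕ) (hn : 0 < n) (hper : Nonempty (shiftFunctor C (n : ℤ) ≅ 𝟭 C))
    (X : C) (t : ℝ) (ht : t ≠ 0) {Z : C} (h : Tow_s14 X Z) :
    ∀ ε : ℝ, 0 < ε → ∃ (r : ℕ) (n : Fin r → ℤ) (Yc : Fin (r + 1) → C),
      IsZero (Yc 0) ∧ Yc (Fin.last r) = Z ∧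
      (∀ i : Fin r, ExTri C (Yc i.castSucc) (Yc i.succ) (X⟦n i⟧)) ∧
      ∑ i, Real.exp ((n i : ℝ) * t) < ε := by
  induction h with
  | zero Z hZ =>
    intro ε hε
    exact ⟨0, Fin.elim0, fun _ => Z, hZ, rfl, fun i => i.elim0, by simpa using hε⟩
  | step Z Z' m h h₀ ih =>
    intro ε hε
    obtain ⟨r, ν, Yc, hz, hl, htri, hc⟩ := ih (ε / 2) (by linarith)
    obtain ⟨m', ⟨e⟩, hm'⟩ := period_small n hn hper X t ht m (ε / 2) (by linarith)
    refine ⟨r + 1, Fin.snoc (α := fun _ => ℤ) ν m', Fin.snoc (α := fun _ => C) Yc Z', ?_, ?_, ?_, ?_⟩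
    · have : (0 : Fin (r + 1 + 1)) = Fin.castSucc 0 := rfl
      rw [this, Fin.snoc_castSucc]
      exact hz
    · simp
    · intro i
      refine Fin.lastCases ?_ (fun i => ?_) i
      · rw [Fin.succ_last, Fin.snoc_last, Fin.snoc_last, Fin.snoc_castSucc, hl]
        exact h.iso (Iso.refl _) (Iso.refl _) e
      · rw [Fin.succ_castSucc, Fin.snoc_castSucc, Fin.snoc_castSucc, Fin.snoc_castSucc]
        exact htri i
    · rw [Fin.sum_univ_castSucc]
      simp only [Fin.snoc_castSucc, Fin.snoc_last]
      linarith

variable (C)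

/-- In an `n`-periodic triangulated category (the shift `[n]` is isomorphic
to the identity, `n > 0`), if `Y ∈ thick X` then `δ_t(X, Y) = 0` for every nonzero real
`t`. -/
theorem stmt_14 (n : ℕ) (hn : 0 < n)
    (hper : Nonempty (shiftFunctor C (n : ℤ) ≅ 𝟭 C))
    (X Y : C) (hY : InThick C X Y) (t : ℝ) (ht : t ≠ 0) :
    dhkkDelta C t X Y = 0 := by
  obtain ⟨V, hV⟩ := (RT.of_inThick hY).compl
  refine le_antisymm ?_ bot_le
  refine ENNReal.le_of_forall_pos_le_add ?_
  intro ε hε _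
  obtain ⟨r, ν, Yc, hz, hl, htri, hc⟩ := hV.cost n hn hper X t ht ε (by exact_mod_cast hε)
  rw [zero_add]
  unfold dhkkDelta
  refine le_trans (sInf_le ⟨r, ν, Yc, V, hz, ⟨eqToIso hl⟩, htri, rfl⟩) ?_
  rw [← ENNReal.ofReal_coe_nnreal]
  exact ENNReal.ofReal_le_ofReal hc.le
end

section
/- Let R be a commutative noetherian local ring of positive dimension, x a non-zerodivisor of R such that R_x is regular of finite global dimension at most d = dim R, and let M be a finitely generated R-module with N = Ω^d M. Then Ext^1_R(N, Ω N) is annihilated by some power x^r of x, and N is isomorphic to a direct summand of Ω_R(N/x^r N). -/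
/-- A commutative noetherian local ring is regular if its maximal ideal can be generated
by (Krull dimension of the ring many) elements. -/
def IsRegularLocal (A : Type) [CommRing A] [IsLocalRing A] : Prop :=
  IsNoetherianRing A ∧ ∃ s : Finset A,
    Ideal.span (s : Set A) = IsLocalRing.maximalIdeal A ∧
      (s.card : WithBot (WithTop ℕ)) = ringKrullDim A

open IsLocalRing

/-- maximal ideal generated by at most `n` elements, and dimension at least `n` -/
def RegL (n : ℕ) (A : Type) [CommRing A] [IsLocalRing A] : Prop :=
  (∃ s : Finset A, Ideal.span (s : Set A) = maximalIdeal A ∧ s.card ≤ n) ∧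
    ((n : ℕ∞) : WithBot ℕ∞) ≤ ringKrullDim A

lemma regL_quot {A : Type} [CommRing A] [IsLocalRing A] [IsNoetherianRing A] {n : ℕ}
    (h : RegL (n + 1) A) (y : A) (hy : y ∈ maximalIdeal A) (hy2 : y ∉ maximalIdeal A ^ 2)
    [IsLocalRing (A ⧸ Ideal.span {y})] : RegL n (A ⧸ Ideal.span {y}) := by
  classical
  obtain ⟨⟨s, hs, hc⟩, hdim⟩ := h
  refine ⟨?_, ?_⟩
  · rw [← hs] at hy
    obtain ⟨a, ha, hay⟩ := Submodule.mem_span_finset.1 hy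
    have : ∃ i ∈ s, a i ∉ maximalIdeal A := by
      by_contra! hcon
      apply hy2
      rw [← hay, pow_two]
      refine Ideal.sum_mem _ fun i hi => ?_
      exact Ideal.mul_mem_mul (hcon i hi) (hs ▸ Ideal.subset_span hi)
    obtain ⟨i, his, hi⟩ := this
    have hiu : IsUnit (a i) := by simpa using hi
    refine ⟨(s.erase i).image (Ideal.Quotient.mk (Ideal.span {y})), ?_, ?_⟩
    · rw [Finset.coe_image, ← Ideal.map_span]
      have hmap : maximalIdeal (A ⧸ Ideal.span {y}) =
          (maximalIdeal A).map (Ideal.Quotient.mk (Ideal.span {y})) := by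
        symm
        have hloc : IsLocalHom (Ideal.Quotient.mk (Ideal.span {y})) :=
          IsLocalHom.of_surjective _ Ideal.Quotient.mk_surjective
        have : (maximalIdeal (A ⧸ Ideal.span {y})).comap
            (Ideal.Quotient.mk (Ideal.span {y})) = maximalIdeal A :=
          ((local_hom_TFAE _).out 0 4).1 hloc
        rw [← this, Ideal.map_comap_of_surjective _ Ideal.Quotient.mk_surjective]
      rw [hmap, ← hs]
      apply le_antisymm
      · exact Ideal.map_mono (Ideal.span_mono (by simp))
      · rw [Ideal.map_span, Ideal.span_le]
        rintro _ ⟨j, hj, rfl⟩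
        by_cases hji : j = i
        · subst hji
          rw [← Finset.add_sum_erase _ _ his] at hay
          have h1 : (Ideal.Quotient.mk (Ideal.span {y})) (a j * j) =
              - (Ideal.Quotient.mk (Ideal.span {y})) (∑ k ∈ s.erase j, a k • k) := by
            rw [eq_neg_iff_add_eq_zero, ← map_add, Ideal.Quotient.eq_zero_iff_mem]
            rw [smul_eq_mul] at hay
            rw [hay]; exact Ideal.mem_span_singleton_self y
          have h2 : (Ideal.Quotient.mk (Ideal.span {y})) (a j * j) ∈
            (Ideal.span (s.erase j : Set A)).map (Ideal.Quotient.mk (Ideal.span {y})) := by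
            rw [h1]
            refine neg_mem (Ideal.mem_map_of_mem _ (Ideal.sum_mem _ fun k hk => ?_))
            exact Ideal.mul_mem_left _ _ (Ideal.subset_span hk)
          rw [map_mul] at h2
          exact (Ideal.unit_mul_mem_iff_mem _ (hiu.map _)).1 h2
        · exact Ideal.mem_map_of_mem _ (Ideal.subset_span (by simpa [hji] using hj))
    · refine Finset.card_image_le.trans ?_
      rw [Finset.card_erase_of_mem his]; omega
  · have h1 := ringKrullDim_le_ringKrullDim_quotient_add_card (R := A) {y}
      (by simpa [IsLocalRing.ringJacobson_eq_maximalIdeal] using hy)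
    simp only [Finset.card_singleton, Nat.cast_one] at h1
    have h2 := hdim.trans h1
    rw [Finset.coe_singleton] at h2
    push_cast at h2
    exact (ENat.WithBot.add_le_add_one_right_iff).1 h2

lemma regL_exists {A : Type} [CommRing A] [IsLocalRing A] [IsNoetherianRing A] {n : ℕ}
    (h : RegL (n + 1) A) : ∃ y ∈ maximalIdeal A, y ∉ maximalIdeal A ^ 2 ∧
      ∀ p ∈ minimalPrimes A, y ∉ p := by
  have hm : maximalIdeal A ∉ minimalPrimes A := by
    intro hm
    have h0 : ringKrullDim A ≤ 0 := by
      rw [← IsLocalRing.maximalIdeal_height_eq_ringKrullDim, Ideal.height_eq_zero_iff.2 hm]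
      simp
    have := h.2.trans h0
    norm_cast at this
  have hfin : (insert (maximalIdeal A ^ 2) (minimalPrimes A)).Finite :=
    (minimalPrimes.finite_of_isNoetherianRing A).insert _
  have key := (Ideal.subset_iUnion_iff_mem_of_isMaximal_of_finite (M := maximalIdeal A) hfin
    (maximalIdeal A ^ 2) (maximalIdeal A ^ 2) (by
      intro I hI h1 _
      rcases hI with rfl | hI
      · exact absurd rfl h1
      · exact Ideal.IsMinimalPrime.isPrime hI)
      (ne_top_of_le_ne_top (Ideal.IsPrime.ne_top (inferInstance : (maximalIdeal A).IsPrime))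
        (Ideal.pow_le_self two_ne_zero))
      (ne_top_of_le_ne_top (Ideal.IsPrime.ne_top (inferInstance : (maximalIdeal A).IsPrime))
        (Ideal.pow_le_self two_ne_zero))).not.2 (by
      rintro (hm2 | hm2)
      · have : maximalIdeal A = ⊥ := by
          apply Submodule.eq_bot_of_le_smul_of_le_jacobson_bot (maximalIdeal A) _
            (IsNoetherian.noetherian _)
          · rw [smul_eq_mul, ← pow_two, ← hm2]
          · exact (IsLocalRing.maximalIdeal_le_jacobson _)
        apply hm
        rw [this]
        have hb : (⊥ : Ideal A).IsPrime := this ▸ inferInstance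
        exact ⟨⟨hb, bot_le⟩, fun _ _ _ => bot_le⟩
      · exact hm hm2)
  rw [Set.not_subset] at key
  obtain ⟨y, hy, hy2⟩ := key
  simp only [Set.mem_iUnion, not_exists] at hy2
  exact ⟨y, hy, hy2 _ (Or.inl rfl), fun p hp => hy2 p (Or.inr hp)⟩

lemma quot_isLocal {A : Type} [CommRing A] [IsLocalRing A] (y : A) (hy : y ∈ maximalIdeal A) :
    IsLocalRing (A ⧸ Ideal.span {y}) := by
  have : Nontrivial (A ⧸ Ideal.span {y}) := by
    apply Ideal.Quotient.nontrivial_iff.2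
    intro h
    rw [Ideal.span_singleton_eq_top] at h
    exact hy h
  exact IsLocalRing.of_surjective' _ Ideal.Quotient.mk_surjective

lemma regL_domain {n : ℕ} : ∀ (A : Type) [CommRing A] [IsLocalRing A] [IsNoetherianRing A],
    RegL n A → IsDomain A := by
  induction n with
  | zero =>
    intro A _ _ _ h
    obtain ⟨s, hs, hc⟩ := h.1
    have : s = ∅ := by simpa using hc
    subst this
    have hb : (⊥ : Ideal A).IsPrime := by
      have : maximalIdeal A = ⊥ := by simpa using hs.symm
      exact this ▸ inferInstance
    exact IsDomain.of_bot_isPrime A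
  | succ n ih =>
    intro A _ _ _ h
    obtain ⟨y, hy, hy2, hyp⟩ := regL_exists h
    have := quot_isLocal y hy
    have := ih _ (regL_quot h y hy hy2)
    have hyprime : (Ideal.span {y}).IsPrime := (Ideal.Quotient.isDomain_iff_prime _).1 this
    obtain ⟨p, hp, hpy⟩ := Ideal.exists_minimalPrimes_le (I := (⊥ : Ideal A))
      (J := Ideal.span {y}) bot_le
    have hpp : p.IsPrime := Ideal.IsMinimalPrime.isPrime hp
    have : p = ⊥ := by
      apply Submodule.eq_bot_of_le_smul_of_le_jacobson_bot (Ideal.span {y}) _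
            (IsNoetherian.noetherian _)
      · intro z hz
        obtain ⟨a, rfl⟩ := Ideal.mem_span_singleton.1 (hpy hz)
        have ha : a ∈ p := (hpp.mem_or_mem hz).resolve_left (hyp p hp)
        exact Ideal.mul_mem_mul (Ideal.mem_span_singleton_self y) ha
      · exact ((Ideal.span_singleton_le_iff_mem _).2 hy).trans (IsLocalRing.maximalIdeal_le_jacobson _)
    rw [this] at hpp
    exact IsDomain.of_bot_isPrime A

open CategoryTheory in
lemma pd_iff_of_exact {B : Type} [CommRing B] {L P K : Type} [AddCommGroup L] [AddCommGroup P]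
    [AddCommGroup K] [Module B L] [Module B P] [Module B K] (f : L →ₗ[B] P) (g : P →ₗ[B] K)
    (hf : Function.Injective f) (hex : Function.Exact f g) (hg : Function.Surjective g)
    [Module.Projective B P] (n : ℕ) :
    HasProjectiveDimensionLE (ModuleCat.of B K) (n + 1) ↔
      HasProjectiveDimensionLE (ModuleCat.of B L) n := by
  let T : ShortComplex (ModuleCat B) :=
    ShortComplex.mk (ModuleCat.ofHom f) (ModuleCat.ofHom g)
      (by ext a; exact hex.apply_apply_eq_zero a)
  have hT : T.ShortExact := ModuleCat.shortComplex_shortExact T hex hf hg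
  have projT : Projective T.X₂ :=
    ModuleCat.projective_of_categoryTheory_projective (ModuleCat.of B P)
  exact hT.hasProjectiveDimensionLT_X₃_iff n projT

open CategoryTheory in
lemma pd_of_quot {A : Type} [CommRing A] [IsLocalRing A] [IsNoetherianRing A] (y : A)
    (hy : y ∈ maximalIdeal A) (hreg : y ∈ nonZeroDivisors A) (n : ℕ) :
    ∀ (K : Type) [AddCommGroup K] [Module A K] [Module.Finite A K], IsSMulRegular K y →
      HasProjectiveDimensionLE (ModuleCat.of (A ⧸ Ideal.span {y}) (QuotSMulTop y K)) n →
      HasProjectiveDimensionLE (ModuleCat.of A K) n := by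
  have := quot_isLocal y hy
  induction n with
  | zero =>
    intro K _ _ _ hK h
    simp only [HasProjectiveDimensionLE, zero_add] at h ⊢
    rw [← projective_iff_hasProjectiveDimensionLT_one, ← IsProjective.iff_projective] at h ⊢
    have hf : Module.FinitePresentation A K := Module.finitePresentation_of_finite A K
    have : Module.Finite (A ⧸ Ideal.span {y}) (QuotSMulTop y K) :=
      Module.Finite.of_restrictScalars_finite A _ _
    have : Module.Free (A ⧸ Ideal.span {y}) (QuotSMulTop y K) :=
      Module.free_of_flat_of_isLocalRing
    have : Module.Free A K := (Module.free_quotSMulTop_iff_free A K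
      (IsLocalRing.maximalIdeal_le_jacobson _ hy) hK).1 this
    infer_instance
  | succ n ih =>
    intro K _ _ _ hK h
    obtain ⟨P, _, _, _, _, f, hf⟩ := Module.exists_finite_presentation A K
    have hP : IsSMulRegular P y :=
      Module.Flat.isSMulRegular_of_nonZeroDivisors hreg
    have hL : IsSMulRegular (LinearMap.ker f) y := by
      intro a b hab
      exact Subtype.ext (hP (congrArg Subtype.val hab))
    refine (pd_iff_of_exact (LinearMap.ker f).subtype f (Submodule.subtype_injective _)
      (LinearMap.exact_subtype_ker_map f) hf n).2 (ih _ hL ?_)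
    let f' : QuotSMulTop y (LinearMap.ker f) →ₗ[A ⧸ Ideal.span {y}] QuotSMulTop y P :=
      (QuotSMulTop.map y (LinearMap.ker f).subtype).extendScalarsOfSurjective
        Ideal.Quotient.mk_surjective
    let g' : QuotSMulTop y P →ₗ[A ⧸ Ideal.span {y}] QuotSMulTop y K :=
      (QuotSMulTop.map y f).extendScalarsOfSurjective Ideal.Quotient.mk_surjective
    have hex : Function.Exact f' g' :=
      QuotSMulTop.map_exact y (LinearMap.exact_subtype_ker_map f) hf
    have hg' : Function.Surjective g' := QuotSMulTop.map_surjective y hf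
    have hf' : Function.Injective f' := by
      rw [injective_iff_map_eq_zero]
      intro a ha
      obtain ⟨⟨a, haf⟩, rfl⟩ := Submodule.Quotient.mk_surjective _ a
      change (Submodule.Quotient.mk a : QuotSMulTop y P) = 0 at ha
      rw [Submodule.Quotient.mk_eq_zero] at ha ⊢
      obtain ⟨b, -, hb⟩ := (Submodule.mem_smul_pointwise_iff_exists _ _ _).1 ha
      have hbf : f b = 0 := by
        apply hK
        simp only [smul_zero]
        rw [← map_smul, hb]; exact haf
      exact (Submodule.mem_smul_pointwise_iff_exists _ _ _).2
        ⟨⟨b, hbf⟩, trivial, Subtype.ext hb⟩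
    exact (pd_iff_of_exact f' g' hf' hex hg' n).1 h

open CategoryTheory in
lemma regL_pd {n : ℕ} : ∀ (A : Type) [CommRing A] [IsLocalRing A] [IsNoetherianRing A],
    RegL n A → ∀ (K : Type) [AddCommGroup K] [Module A K] [Module.Finite A K],
      HasProjectiveDimensionLE (ModuleCat.of A K) n := by
  induction n with
  | zero =>
    intro A _ _ _ h K _ _ _
    obtain ⟨s, hs, hc⟩ := h.1
    have : s = ∅ := by simpa using hc
    subst this
    have hb : maximalIdeal A = ⊥ := by simpa using hs.symm
    have hfield : IsField A := IsLocalRing.isField_iff_maximalIdeal_eq.2 hb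
    let := hfield.toField
    simp only [HasProjectiveDimensionLE, zero_add]
    rw [← projective_iff_hasProjectiveDimensionLT_one, ← IsProjective.iff_projective]
    infer_instance
  | succ n ih =>
    intro A _ _ _ h K _ _ _
    have hdom := regL_domain A h
    obtain ⟨y, hy, hy2, hyp⟩ := regL_exists h
    have := quot_isLocal y hy
    have hy0 : y ≠ 0 := by
      rintro rfl; exact hy2 (zero_mem _)
    obtain ⟨P, _, _, _, _, f, hf⟩ := Module.exists_finite_presentation A K
    refine (pd_iff_of_exact (LinearMap.ker f).subtype f (Submodule.subtype_injective _)
      (LinearMap.exact_subtype_ker_map f) hf n).2 ?_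
    have hL : IsSMulRegular (LinearMap.ker f) y := by
      intro a b hab
      have hP : IsSMulRegular P y :=
        Module.Flat.isSMulRegular_of_nonZeroDivisors (mem_nonZeroDivisors_of_ne_zero hy0)
      exact Subtype.ext (hP (congrArg Subtype.val hab))
    have : Module.Finite (A ⧸ Ideal.span {y}) (QuotSMulTop y (LinearMap.ker f)) :=
      Module.Finite.of_restrictScalars_finite A _ _
    exact pd_of_quot y hy (mem_nonZeroDivisors_of_ne_zero hy0) n _ hL (ih _ (regL_quot h y hy hy2) _)

lemma regL_of_regular {A : Type} [CommRing A] [IsLocalRing A] (h : IsRegularLocal A) :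
    ∃ n : ℕ, RegL n A ∧ ((n : ℕ∞) : WithBot ℕ∞) = ringKrullDim A := by
  obtain ⟨_, s, hs, hc⟩ := h
  exact ⟨s.card, ⟨⟨s, hs, le_rfl⟩, hc.le⟩, hc⟩

open CategoryTheory in
lemma pd_of_regular (B : Type) [CommRing B] [IsNoetherianRing B] (d : ℕ)
    (hreg : ∀ p : PrimeSpectrum B, IsRegularLocal (Localization.AtPrime p.asIdeal))
    (hgl : ringKrullDim B ≤ ((d : ℕ∞) : WithBot ℕ∞)) (M : ModuleCat.{0} B) [Module.Finite B M] :
    HasProjectiveDimensionLE M d := by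
  rw [ModuleCat.hasProjectiveDimensionLE_iff_forall_primeSpectrum]
  intro p
  obtain ⟨n, hn, hnd⟩ := regL_of_regular (hreg p)
  have hle : n ≤ d := by
    have h1 : ringKrullDim (Localization.AtPrime p.asIdeal) ≤ ringKrullDim B := by
      rw [IsLocalization.AtPrime.ringKrullDim_eq_height p.asIdeal]
      exact Ideal.height_le_ringKrullDim_of_ne_top p.2.ne_top
    have h2 := (hnd.le.trans h1).trans hgl
    exact_mod_cast h2
  have : IsNoetherianRing (Localization.AtPrime p.asIdeal) :=
    IsLocalization.isNoetherianRing p.asIdeal.primeCompl _ inferInstance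
  have : Module.Finite (Localization.AtPrime p.asIdeal) (M.localizedModule p.1.primeCompl) :=
    Module.Finite.of_isLocalizedModule p.1.primeCompl
      (M.localizedModuleMkLinearMap p.1.primeCompl)
  have h3 : HasProjectiveDimensionLT (M.localizedModule p.1.primeCompl) (n + 1) :=
    regL_pd _ hn (M.localizedModule p.1.primeCompl)
  exact hasProjectiveDimensionLT_of_ge _ (n + 1) (d + 1) (by omega)

lemma isSyzygy_finite {R : Type} [CommRing R] [IsNoetherianRing R] {d : ℕ} {N : ModuleCat R} :
    ∀ {M : ModuleCat R} [Module.Finite R M], IsSyzygy R d N M → Module.Finite R N := by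
  induction d with
  | zero =>
    rintro M _ ⟨e⟩
    exact Module.Finite.equiv e.symm
  | succ d ih =>
    rintro M _ ⟨P, f, _, _, hf, h⟩
    exact ih h

lemma isSyzygy_regular {R : Type} [CommRing R] [IsNoetherianRing R] {x : R}
    (hx : x ∈ nonZeroDivisors R) {d : ℕ} {N : ModuleCat R} :
    ∀ {M : ModuleCat R}, IsSyzygy R (d + 1) N M → IsSMulRegular N x := by
  induction d with
  | zero =>
    rintro M ⟨P, f, _, _, hf, ⟨e⟩⟩
    intro a b hab
    have hP : IsSMulRegular P x := Module.Flat.isSMulRegular_of_nonZeroDivisors hx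
    apply e.injective
    apply Subtype.ext
    apply hP
    have := congrArg (fun z => ((e z : LinearMap.ker f) : P)) hab
    simpa using this
  | succ d ih =>
    rintro M ⟨P, f, _, _, hf, h⟩
    exact ih h

open CategoryTheory in
lemma isSyzygy_pd {R : Type} [CommRing R] (S : Submonoid R) {d : ℕ} {N : ModuleCat R} :
    ∀ {M : ModuleCat R}, IsSyzygy R d N M → HasProjectiveDimensionLE (M.localizedModule S) d →
      HasProjectiveDimensionLE (N.localizedModule S) 0 := by
  induction d with
  | zero =>
    rintro M ⟨e⟩ h
    have h' : HasProjectiveDimensionLT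
      ((ModuleCat.localizedModuleFunctor S).obj (ModuleCat.of R M)) 1 := h
    exact hasProjectiveDimensionLT_of_iso
      ((ModuleCat.localizedModuleFunctor S).mapIso e.symm.toModuleIso) 1
  | succ d ih =>
    rintro M ⟨P, f, _, _, hf, h⟩ hM
    refine ih h ?_
    have hS := (LinearMap.shortExact_shortComplexKer hf).map_of_exact
      (ModuleCat.localizedModuleFunctor.{0} S)
    have proj : Projective P :=
      ModuleCat.projective_of_categoryTheory_projective P
    have projp := (ModuleCat.localizedModuleFunctor.{0} S).projective_obj_of_projective proj
    exact (hS.hasProjectiveDimensionLT_X₃_iff d projp).1 hM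

open CategoryTheory in
lemma exists_splitting {R : Type} [CommRing R] [IsNoetherianRing R] (x : R)
    (N P : ModuleCat R) [Module.Finite R N] (π : P →ₗ[R] N) (hπ : Function.Surjective π)
    (hN : IsSMulRegular N x)
    (hpd : HasProjectiveDimensionLE (N.localizedModule (Submonoid.powers x)) 0) :
    ∃ r : ℕ, 0 < r ∧ ∃ s : N →ₗ[R] P, ∀ n, π (s n) = x ^ r • n := by
  have hproj : Module.Projective (Localization (Submonoid.powers x))
      (N.localizedModule (Submonoid.powers x)) := by
    simp only [HasProjectiveDimensionLE, zero_add] at hpd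
    rwa [← projective_iff_hasProjectiveDimensionLT_one, ← IsProjective.iff_projective] at hpd
  let S := Submonoid.powers x
  let iN := N.localizedModuleMkLinearMap S
  let iP := P.localizedModuleMkLinearMap S
  let πx := IsLocalizedModule.mapExtendScalars S iP iN (Localization S) π
  have hπx : Function.Surjective πx := IsLocalizedModule.map_surjective S iP iN π hπ
  obtain ⟨t, ht⟩ := Module.projective_lifting_property πx LinearMap.id hπx
  have hfp : Module.FinitePresentation R N := Module.finitePresentation_of_finite R N
  obtain ⟨s, ⟨c, r, hr⟩, hs⟩ := Module.FinitePresentation.exists_lift_of_isLocalizedModule S iP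
    ((t.restrictScalars R) ∘ₗ iN)
  have hr' : x ^ r = c := hr
  subst hr'
  refine ⟨r + 1, by omega, x • s, fun n => ?_⟩
  have hinj : ∀ a b : N, iN a = iN b → a = b := by
    intro a b hab
    obtain ⟨⟨_, k, rfl⟩, hk⟩ := (IsLocalizedModule.eq_iff_exists S iN).1 hab
    exact (hN.pow k) hk
  have h1 : π (s n) = x ^ r • n := by
    apply hinj
    have h2 : iP (s n) = x ^ r • t (iN n) := LinearMap.congr_fun hs n
    have h3 : iN (π (s n)) = πx (iP (s n)) := (IsLocalizedModule.map_apply S iP iN π (s n)).symm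
    have h4 : πx (t (iN n)) = iN n := LinearMap.congr_fun ht (iN n)
    have h5 : πx (x ^ r • t (iN n)) = x ^ r • πx (t (iN n)) :=
      (πx.restrictScalars R).map_smul _ _
    rw [h3, h2, h5, h4, map_smul]
  rw [LinearMap.smul_apply, map_smul, h1, smul_smul, pow_succ']

universe u in
lemma summand_of_splitting {R : Type} [CommRing R] (c : R)
    (N P : ModuleCat.{0} R) [Module.Finite R P] [Module.Projective R P]
    (π : P →ₗ[R] N) (hπ : Function.Surjective π)
    (hN : IsSMulRegular N c) (s : N →ₗ[R] P) (hs : ∀ n, π (s n) = c • n) :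
    ∃ (ΩQ : ModuleCat.{0} R) (W : ModuleCat.{u} R),
      IsSyzygy R 1 ΩQ
        (ModuleCat.of R
          ((N : Type) ⧸ (Ideal.span {c} • (⊤ : Submodule R (N : Type))))) ∧
      Nonempty ((ΩQ : Type) ≃ₗ[R] Prod (N : Type) W) := by
  let q : P →ₗ[R] ((N : Type) ⧸ (Ideal.span {c} • (⊤ : Submodule R (N : Type)))) :=
    (Ideal.span {c} • (⊤ : Submodule R (N : Type))).mkQ ∘ₗ π
  have hq : ∀ p, q p = 0 ↔ ∃ n, π p = c • n := by
    intro p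
    change Submodule.Quotient.mk (π p) = 0 ↔ _
    rw [Submodule.Quotient.mk_eq_zero, Submodule.ideal_span_singleton_smul,
      Submodule.mem_smul_pointwise_iff_exists]
    constructor
    · rintro ⟨n, -, h⟩; exact ⟨n, h.symm⟩
    · rintro ⟨n, h⟩; exact ⟨n, trivial, h.symm⟩
  let i : N →ₗ[R] LinearMap.ker q := s.codRestrict _ fun n => (hq _).2 ⟨n, hs n⟩
  choose ρ hρ using fun p : LinearMap.ker q => (hq p).1 p.2
  let j : LinearMap.ker q →ₗ[R] N :=
    { toFun := ρ
      map_add' := fun a b => hN (by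
        change c • _ = c • _
        rw [smul_add, ← hρ, ← hρ, ← hρ, ← map_add]; rfl)
      map_smul' := fun a b => hN (by
        change c • _ = c • _
        rw [RingHom.id_apply, smul_comm c a, ← hρ, ← hρ, ← map_smul]; rfl) }
  have hji : ∀ n, j (i n) = n := fun n => hN (by
    change c • ρ (i n) = c • n
    rw [← hρ, ← hs]; rfl)
  refine ⟨ModuleCat.of R (LinearMap.ker q), ModuleCat.of R (ULift.{u} (LinearMap.ker j)),
    ⟨P, q, inferInstance, inferInstance, (Submodule.mkQ_surjective _).comp hπ,
      ⟨LinearEquiv.refl R _⟩⟩, ⟨?_⟩⟩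
  have hk : ∀ a, (LinearMap.id - i ∘ₗ j : LinearMap.ker q →ₗ[R] LinearMap.ker q) a ∈
      LinearMap.ker j := by
    intro a
    simp [hji]
  let k : LinearMap.ker q →ₗ[R] LinearMap.ker j :=
    (LinearMap.id - i ∘ₗ j : LinearMap.ker q →ₗ[R] LinearMap.ker q).codRestrict _ hk
  have hkv : ∀ a, (k a : LinearMap.ker q) = a - i (j a) := fun a => rfl
  have hE : Function.Bijective (j.prod k) := by
    constructor
    · intro a b hab
      have h1 : j a = j b := congrArg Prod.fst hab
      have h2 : (k a : LinearMap.ker q) = k b := congrArg Subtype.val (congrArg Prod.snd hab)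
      rw [hkv, hkv, h1] at h2
      exact sub_left_injective h2
    · rintro ⟨n, w⟩
      have hw : j w = 0 := w.2
      have h1 : j (i n + w) = n := by rw [map_add, hji, hw, add_zero]
      refine ⟨i n + w, Prod.ext h1 (Subtype.ext ?_)⟩
      change (k (i n + w) : LinearMap.ker q) = w
      rw [hkv, h1]
      abel
  let E : LinearMap.ker q ≃ₗ[R] Prod N (LinearMap.ker j) := LinearEquiv.ofBijective _ hE
  exact E.trans (LinearEquiv.prodCongr (LinearEquiv.refl R N)
    (ULift.moduleEquiv (R := R) (M := LinearMap.ker j)).symm)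

open CategoryTheory in
lemma ext_annihilated {R : Type} [CommRing R] (c : R)
    (N P : ModuleCat.{0} R) [Module.Projective R P]
    (π : P →ₗ[R] N) (s : N →ₗ[R] P) (hs : ∀ n, π (s n) = c • n) (Y : ModuleCat.{0} R)
    (e : (((Ext R (ModuleCat R) 1).obj (Opposite.op N)).obj Y : Type)) : c • e = 0 := by
  let Q : ProjectiveResolution N := projectiveResolution N
  let C := Q.complex.linearYonedaObj R Y
  let φ := Q.isoExt (R := R) 1 Y
  suffices h : ∀ e : C.homology 1, c • e = 0 by
    have h1 : φ.inv (φ.hom e) = e := by simp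
    have h2 := h (φ.hom e)
    rw [← h1, ← map_smul, h2, map_zero]
  intro e
  obtain ⟨z, rfl⟩ := (ModuleCat.epi_iff_surjective (C.homologyπ 1)).1 inferInstance e
  rw [← map_smul]
  have : Projective P := ModuleCat.projective_of_categoryTheory_projective P
  -- the map `s₀ : N ⟶ Q₀` with `s₀ ≫ ε = c`
  obtain ⟨ε, hepi, hd0, hex⟩ : ∃ ε : Q.complex.X 0 ⟶ N, Epi ε ∧
      ∃ w : Q.complex.d 1 0 ≫ ε = 0, (ShortComplex.mk (Q.complex.d 1 0) ε w).Exact :=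
    ⟨Q.π.f 0, (inferInstance : Epi (Q.π.f 0)), Q.complex_d_comp_π_f_zero, Q.exact₀⟩
  obtain ⟨s₀, hs₀⟩ : ∃ s₀ : N ⟶ Q.complex.X 0, s₀ ≫ ε = c • 𝟙 N := by
    refine ⟨ModuleCat.ofHom s ≫ Projective.factorThru (ModuleCat.ofHom π) ε, ?_⟩
    rw [Category.assoc, Projective.factorThru_comp]
    ext n
    exact hs n
  have hp0 : Projective (Q.complex.X 0) := Q.projective 0
  have hp1 : Projective (Q.complex.X 1) := Q.projective 1
  obtain ⟨u, hu⟩ : ∃ u : Q.complex.X 0 ⟶ Q.complex.X 1,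
      u ≫ Q.complex.d 1 0 = c • 𝟙 (Q.complex.X 0) - ε ≫ s₀ := by
    refine ⟨hex.liftFromProjective (c • 𝟙 (Q.complex.X 0) - ε ≫ s₀) ?_,
      hex.liftFromProjective_comp _ _⟩
    change (c • 𝟙 (Q.complex.X 0) - ε ≫ s₀) ≫ ε = 0
    rw [Preadditive.sub_comp, Category.assoc, hs₀]
    simp
  obtain ⟨v, hv⟩ : ∃ v : Q.complex.X 1 ⟶ Q.complex.X 2,
      v ≫ Q.complex.d 2 1 = c • 𝟙 (Q.complex.X 1) - Q.complex.d 1 0 ≫ u := by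
    refine ⟨(Q.exact_succ 0).liftFromProjective
      (c • 𝟙 (Q.complex.X 1) - Q.complex.d 1 0 ≫ u) ?_,
      (Q.exact_succ 0).liftFromProjective_comp _ _⟩
    change (c • 𝟙 (Q.complex.X 1) - Q.complex.d 1 0 ≫ u) ≫ Q.complex.d 1 0 = 0
    rw [Preadditive.sub_comp, Category.assoc, hu, Preadditive.comp_sub, ← Category.assoc, hd0]
    simp
  let z' : Q.complex.X 1 ⟶ Y := C.iCycles 1 z
  have hz' : Q.complex.d 2 1 ≫ z' = 0 := by
    have := congrArg (fun f => f.hom z) (C.iCycles_d 1 2)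
    exact this
  have key : c • z' = Q.complex.d 1 0 ≫ u ≫ z' := by
    have h1 := congrArg (fun f => f ≫ z') hv
    simp only [Category.assoc, hz', Limits.comp_zero, Preadditive.sub_comp,
      Linear.smul_comp, Category.id_comp] at h1
    exact sub_eq_zero.1 h1.symm
  have hcz : c • z = C.toCycles 0 1 (u ≫ z' : Q.complex.X 0 ⟶ Y) := by
    apply (ModuleCat.mono_iff_injective (C.iCycles 1)).1 inferInstance
    have h2 := congrArg (fun f => f.hom (u ≫ z' : Q.complex.X 0 ⟶ Y)) (C.toCycles_i 0 1)
    refine Eq.trans ?_ h2.symm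
    rw [map_smul]
    exact key
  rw [hcz]
  exact congrArg (fun f => f.hom (u ≫ z' : Q.complex.X 0 ⟶ Y)) (C.toCycles_comp_homologyπ 0 1)

universe v in
lemma isSyzygy_transport {R : Type} [CommRing R] {d : ℕ} {N : ModuleCat.{0} R} :
    ∀ {M : ModuleCat.{v} R} {M' : ModuleCat.{0} R} (_ : M ≃ₗ[R] M'),
      IsSyzygy R d N M → IsSyzygy R d N M' := by
  induction d with
  | zero =>
    rintro M M' e ⟨g⟩
    exact ⟨g.trans e⟩
  | succ d ih =>
    rintro M M' e ⟨P, f, hfin, hproj, hf, h⟩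
    obtain ⟨n, g, hg⟩ := Module.Finite.exists_fin' R P
    have : Small.{0} P := small_of_surjective hg
    let σ : Shrink.{0} P ≃ₗ[R] P := Shrink.linearEquiv R P
    let f' : Shrink.{0} P →ₗ[R] M' := (e : M →ₗ[R] M') ∘ₗ f ∘ₗ (σ : Shrink.{0} P →ₗ[R] P)
    have hf' : ∀ p, f' p = e (f (σ p)) := fun p => rfl
    refine ⟨ModuleCat.of R (Shrink.{0} P), f', Module.Finite.equiv σ.symm,
      Module.Projective.of_equiv σ.symm, e.surjective.comp (hf.comp σ.surjective), ?_⟩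
    refine ih ?_ h
    exact LinearEquiv.ofSubmodules σ.symm _ _ (by
      ext p
      simp only [Submodule.mem_map, LinearMap.mem_ker, hf']
      constructor
      · rintro ⟨y, hy, rfl⟩
        simp [hy]
      · intro hp
        exact ⟨σ p, by simpa using hp, by simp⟩)

lemma finite_localizedModule {R : Type} [CommRing R] (S : Submonoid R) (M : ModuleCat.{0} R)
    [Module.Finite R M] : Module.Finite (Localization S) (M.localizedModule S) :=
  Module.Finite.of_isLocalizedModule S (M.localizedModuleMkLinearMap S)

/-- Let `R` be a commutative noetherian local ring of positive dimension
`d < ∞`, `x` a non-zerodivisor such that `R_x` is regular (of dimension, hence global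
dimension, at most `d`), `M` finitely generated and `N = Ω^d M`. Then `Ext¹_R(N, Ω N)` is
annihilated by some power `x^r`, and `N` is a direct summand of `Ω_R(N / x^r N)`. -/
theorem stmt_15 (R : Type) [CommRing R] [IsNoetherianRing R] [IsLocalRing R]
    (d : ℕ) (hd : ringKrullDim R = (d : WithBot (WithTop ℕ))) (hd0 : 0 < d)
    (x : R) (hx : x ∈ nonZeroDivisors R)
    (hreg : ∀ p : PrimeSpectrum (Localization.Away x),
      IsRegularLocal (Localization.AtPrime p.asIdeal))
    (hgl : ringKrullDim (Localization.Away x) ≤ (d : WithBot (WithTop ℕ)))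
    (M N : ModuleCat R) [Module.Finite R M] (hN : IsSyzygy R d N M) :
    (∀ ΩN : ModuleCat R, IsSyzygy R 1 ΩN N → ∃ r : ℕ, 0 < r ∧
      ∀ e : (((Ext R (ModuleCat R) 1).obj (Opposite.op N)).obj ΩN : Type),
        x ^ r • e = 0) ∧
    ∃ r : ℕ, 0 < r ∧ ∃ ΩQ W : ModuleCat R,
      IsSyzygy R 1 ΩQ
        (ModuleCat.of R
          ((N : Type) ⧸ (Ideal.span {x ^ r} • (⊤ : Submodule R (N : Type))))) ∧
      Nonempty ((ΩQ : Type) ≃ₗ[R] Prod (N : Type) W) := by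
  obtain ⟨d', rfl⟩ : ∃ d', d = d' + 1 := ⟨d - 1, by omega⟩
  have hNfin : Module.Finite R N := isSyzygy_finite hN
  have hNreg : IsSMulRegular N x := isSyzygy_regular hx hN
  obtain ⟨m, g, hg⟩ := Module.Finite.exists_fin' R M
  have hsmall : Small.{0} M := small_of_surjective hg
  let M' : ModuleCat.{0} R := ModuleCat.of R (Shrink.{0} M)
  let σ : M ≃ₗ[R] M' := (Shrink.linearEquiv R M).symm
  have hM'fin : Module.Finite R M' := Module.Finite.equiv σ
  have hN' : IsSyzygy R (d' + 1) N M' := isSyzygy_transport σ hN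
  have hnoeth : IsNoetherianRing (Localization.Away x) :=
    IsLocalization.isNoetherianRing (Submonoid.powers x) _ inferInstance
  have hMx : Module.Finite (Localization.Away x) (M'.localizedModule (Submonoid.powers x)) :=
    finite_localizedModule (Submonoid.powers x) M'
  have hpdM : CategoryTheory.HasProjectiveDimensionLE
      (M'.localizedModule (Submonoid.powers x)) (d' + 1) :=
    pd_of_regular (Localization.Away x) (d' + 1) hreg hgl
      (M'.localizedModule (Submonoid.powers x))
  have hpdN := isSyzygy_pd (Submonoid.powers x) hN' hpdM
  obtain ⟨n, π, hπ⟩ := Module.Finite.exists_fin' R N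
  let P : ModuleCat.{0} R := ModuleCat.of R (Fin n → R)
  have hPfin : Module.Finite R P := inferInstanceAs (Module.Finite R (Fin n → R))
  have hPproj : Module.Projective R P := inferInstanceAs (Module.Projective R (Fin n → R))
  obtain ⟨r, hr, s, hs⟩ := exists_splitting x N P π hπ hNreg hpdN
  exact ⟨fun Y _ => ⟨r, hr, ext_annihilated (x ^ r) N P π s hs Y⟩,
    r, hr, summand_of_splitting (x ^ r) N P π hπ (hNreg.pow r) s hs⟩
end
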